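/- Given ε>0, under Assumptions (A1)–(A4), suppose f = l ∘ c, where c : ℝ^d → ℝ^p is differentiable with L_c-Lipschitz derivative and l : ℝ^p → ℝ is convex and M_l-Lipschitz, and set ρ := M_l·L_c. Let {x^k, y^k, z^k} be generated by DPALM with β_k, v_k as in the parameter choice, where each x^{k+1} satisfies dist(0, ∂_x L̃^{ν}_{β_k}(x^{k+1}; y^k, z^k)) ≤ ε_k := min{ε/(16C₄), √(ρ/(2β_k)), 1}, with ν := min{1, ε²/(64 C₄² ρ M_l²)}. Then for some k ≤ K := ⌈C₅ ε⁻²⌉ + ⌈64 ρ C_x C₄² ε⁻²⌉, the iterate x^k is a near ε-KKT point of problem (P). -/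

import Mathlib

noncomputable section

open scoped RealInnerProductSpace
open Metric

/-- Convex subdifferential of `φ` relative to the set `X` (the effective domain):
`∂φ(x) = {ξ | ∀ u ∈ X, φ(u) ≥ φ(x) + ⟨ξ, u − x⟩}`. -/
def csubdiff {E : Type*} [NormedAddCommGroup E] [InnerProductSpace ℝ E]
    (X : Set E) (φ : E → ℝ) (x : E) : Set E :=
  {ξ | ∀ u ∈ X, φ x + ⟪ξ, u - x⟫ ≤ φ u}

/-- Subdifferential of a `ρ`-weakly convex function `φ` (relative to the domain `X`):
`∂φ(x) := ∂(φ + (ρ/2)‖·‖²)(x) − ρx`, the latter being the convex subdifferential. -/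
def wsubdiff {E : Type*} [NormedAddCommGroup E] [InnerProductSpace ℝ E]
    (X : Set E) (ρ : ℝ) (φ : E → ℝ) (x : E) : Set E :=
  {ξ | ξ + ρ • x ∈ csubdiff X (fun u => φ u + ρ / 2 * ‖u‖ ^ 2) x}

open Classical in
/-- Moore–Penrose pseudoinverse of a continuous linear map on a real inner product space
(defined via its characterizing equations; `0` if no such map exists). -/
def mpPinv {F : Type*} [NormedAddCommGroup F] [InnerProductSpace ℝ F] [CompleteSpace F]
    (T : F →L[ℝ] F) : F →L[ℝ] F :=
  if hT : ∃ S : F →L[ℝ] F,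
      T.comp (S.comp T) = T ∧ S.comp (T.comp S) = S ∧
      ContinuousLinearMap.adjoint (T.comp S) = T.comp S ∧
      ContinuousLinearMap.adjoint (S.comp T) = S.comp T
  then hT.choose else 0

/-- On a compact ball large enough, `l + ‖· - w‖²/(2ν)` attains its infimum. -/
theorem moreau_exists_min {V : Type*} [NormedAddCommGroup V] [InnerProductSpace ℝ V]
    [FiniteDimensional ℝ V] {l e : V → ℝ} {M ν : ℝ} (hν : 0 < ν)
    (hl : ∀ u w, |l u - l w| ≤ M * ‖u - w‖)
    (he : ∀ w, e w = sInf {t : ℝ | ∃ q, t = l q + ‖q - w‖ ^ 2 / (2 * ν)}) (w : V) :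
    ∃ q, e w = l q + ‖q - w‖ ^ 2 / (2 * ν) ∧
      ∀ q', l q + ‖q - w‖ ^ 2 / (2 * ν) ≤ l q' + ‖q' - w‖ ^ 2 / (2 * ν) := by
  have hcont : Continuous l := by
    refine LipschitzWith.continuous (K := M.toNNReal) (LipschitzWith.of_dist_le_mul fun u v => ?_)
    rw [Real.dist_eq, dist_eq_norm]
    exact (hl u v).trans (mul_le_mul_of_nonneg_right (Real.le_coe_toNNReal M) (norm_nonneg _))
  have hcont' : Continuous fun q => l q + ‖q - w‖ ^ 2 / (2 * ν) := by fun_prop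
  have : ProperSpace V := FiniteDimensional.proper ℝ V
  obtain ⟨q, -, hq⟩ := (isCompact_closedBall w (2 * ν * |M|)).exists_isMinOn
    ⟨w, mem_closedBall_self (by positivity)⟩ hcont'.continuousOn
  have hmin : ∀ q', l q + ‖q - w‖ ^ 2 / (2 * ν) ≤ l q' + ‖q' - w‖ ^ 2 / (2 * ν) := by
    intro q'
    by_cases hq' : q' ∈ closedBall w (2 * ν * |M|)
    · exact hq hq'
    · have h1 : l q + ‖q - w‖ ^ 2 / (2 * ν) ≤ l w := by
        simpa using hq (mem_closedBall_self (x := w) (ε := 2 * ν * |M|) (by positivity))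
      rw [mem_closedBall, dist_eq_norm, not_le] at hq'
      have h2 := (abs_le.1 (hl q' w)).1
      have h3 : M * ‖q' - w‖ ≤ |M| * ‖q' - w‖ :=
        mul_le_mul_of_nonneg_right (le_abs_self M) (norm_nonneg _)
      have h4 : |M| * ‖q' - w‖ ≤ ‖q' - w‖ ^ 2 / (2 * ν) := by
        rw [le_div_iff₀ (by positivity)]
        nlinarith [norm_nonneg (q' - w)]
      linarith
  refine ⟨q, ?_, hmin⟩
  rw [he w]
  refine IsLeast.csInf_eq ⟨⟨q, rfl⟩, ?_⟩
  rintro _ ⟨q', rfl⟩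
  exact hmin q'

theorem moreau_le {V : Type*} [NormedAddCommGroup V] [InnerProductSpace ℝ V]
    [FiniteDimensional ℝ V] {l e : V → ℝ} {M ν : ℝ} (hν : 0 < ν)
    (hl : ∀ u w, |l u - l w| ≤ M * ‖u - w‖)
    (he : ∀ w, e w = sInf {t : ℝ | ∃ q, t = l q + ‖q - w‖ ^ 2 / (2 * ν)}) (w q : V) :
    e w ≤ l q + ‖q - w‖ ^ 2 / (2 * ν) := by
  obtain ⟨q₀, h1, h2⟩ := moreau_exists_min hν hl he w
  exact h1 ▸ h2 q

theorem moreau_le_self {V : Type*} [NormedAddCommGroup V] [InnerProductSpace ℝ V]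
    [FiniteDimensional ℝ V] {l e : V → ℝ} {M ν : ℝ} (hν : 0 < ν)
    (hl : ∀ u w, |l u - l w| ≤ M * ‖u - w‖)
    (he : ∀ w, e w = sInf {t : ℝ | ∃ q, t = l q + ‖q - w‖ ^ 2 / (2 * ν)}) (w : V) :
    e w ≤ l w := by
  simpa using moreau_le hν hl he w w

theorem self_sub_le_moreau {V : Type*} [NormedAddCommGroup V] [InnerProductSpace ℝ V]
    [FiniteDimensional ℝ V] {l e : V → ℝ} {M ν : ℝ} (hν : 0 < ν)
    (hl : ∀ u w, |l u - l w| ≤ M * ‖u - w‖)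
    (he : ∀ w, e w = sInf {t : ℝ | ∃ q, t = l q + ‖q - w‖ ^ 2 / (2 * ν)}) (w : V) :
    l w - ν * M ^ 2 / 2 ≤ e w := by
  obtain ⟨q, h1, -⟩ := moreau_exists_min hν hl he w
  have h2 := (abs_le.1 (hl q w)).1
  have h3 : M * ‖q - w‖ - ν * M ^ 2 / 2 ≤ ‖q - w‖ ^ 2 / (2 * ν) := by
    rw [le_div_iff₀ (by positivity)]
    nlinarith [sq_nonneg (‖q - w‖ - ν * M)]
  linarith

theorem moreau_lipschitz {V : Type*} [NormedAddCommGroup V] [InnerProductSpace ℝ V]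
    [FiniteDimensional ℝ V] {l e : V → ℝ} {M ν : ℝ} (hν : 0 < ν)
    (hl : ∀ u w, |l u - l w| ≤ M * ‖u - w‖)
    (he : ∀ w, e w = sInf {t : ℝ | ∃ q, t = l q + ‖q - w‖ ^ 2 / (2 * ν)}) (w w' : V) :
    |e w - e w'| ≤ M * ‖w - w'‖ := by
  have key : ∀ u v, e u - e v ≤ M * ‖u - v‖ := by
    intro u v
    obtain ⟨q, h1, -⟩ := moreau_exists_min hν hl he v
    have h2 := moreau_le hν hl he u (q + (u - v))
    have h3 := (abs_le.1 (hl (q + (u - v)) q)).2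
    rw [add_sub_cancel_left] at h3
    rw [show q + (u - v) - u = q - v by abel] at h2
    linarith
  rw [abs_le]
  constructor
  · have := key w' w
    rw [norm_sub_rev] at this
    linarith
  · exact key w w'

theorem moreau_convexOn {V : Type*} [NormedAddCommGroup V] [InnerProductSpace ℝ V]
    [FiniteDimensional ℝ V] {l e : V → ℝ} {M ν : ℝ} (hν : 0 < ν)
    (hl : ∀ u w, |l u - l w| ≤ M * ‖u - w‖) (hconv : ConvexOn ℝ Set.univ l)
    (he : ∀ w, e w = sInf {t : ℝ | ∃ q, t = l q + ‖q - w‖ ^ 2 / (2 * ν)}) :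
    ConvexOn ℝ Set.univ e := by
  refine ⟨convex_univ, fun w _ w' _ a b ha hb hab => ?_⟩
  obtain ⟨q, h1, -⟩ := moreau_exists_min hν hl he w
  obtain ⟨q', h1', -⟩ := moreau_exists_min hν hl he w'
  have h2 := moreau_le hν hl he (a • w + b • w') (a • q + b • q')
  have h3 := hconv.2 (Set.mem_univ q) (Set.mem_univ q') ha hb hab
  have hsq : ConvexOn ℝ Set.univ fun u : V => ‖u‖ ^ 2 :=
    (convexOn_norm convex_univ).pow (fun _ _ => norm_nonneg _) 2
  have h4 := hsq.2 (Set.mem_univ (q - w)) (Set.mem_univ (q' - w')) ha hb hab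
  rw [show a • q + b • q' - (a • w + b • w') = a • (q - w) + b • (q' - w') by module] at h2
  simp only [smul_eq_mul] at h3 h4 ⊢
  have h5 : ‖a • (q - w) + b • (q' - w')‖ ^ 2 / (2 * ν)
      ≤ (a * ‖q - w‖ ^ 2 + b * ‖q' - w'‖ ^ 2) / (2 * ν) := by gcongr
  have h6 : (a * ‖q - w‖ ^ 2 + b * ‖q' - w'‖ ^ 2) / (2 * ν)
      = a * (‖q - w‖ ^ 2 / (2 * ν)) + b * (‖q' - w'‖ ^ 2 / (2 * ν)) := by ring
  rw [h1, h1']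
  linarith

theorem moreau_differentiable {V : Type*} [NormedAddCommGroup V] [InnerProductSpace ℝ V]
    [FiniteDimensional ℝ V] {l e : V → ℝ} {M ν : ℝ} (hν : 0 < ν)
    (hl : ∀ u w, |l u - l w| ≤ M * ‖u - w‖) (hconv : ConvexOn ℝ Set.univ l)
    (he : ∀ w, e w = sInf {t : ℝ | ∃ q, t = l q + ‖q - w‖ ^ 2 / (2 * ν)}) :
    Differentiable ℝ e := by
  intro w
  obtain ⟨q, h1, -⟩ := moreau_exists_min hν hl he w
  set s : V := ν⁻¹ • (w - q) with hs
  have upper : ∀ w', e w' ≤ e w + ⟪s, w' - w⟫ + ‖w' - w‖ ^ 2 / (2 * ν) := by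
    intro w'
    have h2 := moreau_le hν hl he w' q
    have h3 : ‖q - w'‖ ^ 2 = ‖q - w‖ ^ 2 + 2 * ⟪w - q, w' - w⟫ + ‖w' - w‖ ^ 2 := by
      rw [show q - w' = -((w - q) + (w' - w)) by abel, norm_neg, norm_add_sq_real,
        norm_sub_rev w q]
    rw [h3] at h2
    rw [hs, real_inner_smul_left, h1]
    have h4 : (‖q - w‖ ^ 2 + 2 * ⟪w - q, w' - w⟫ + ‖w' - w‖ ^ 2) / (2 * ν)
        = ‖q - w‖ ^ 2 / (2 * ν) + ν⁻¹ * ⟪w - q, w' - w⟫ + ‖w' - w‖ ^ 2 / (2 * ν) := by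
      field_simp
    linarith
  have lower : ∀ w', e w + ⟪s, w' - w⟫ - ‖w' - w‖ ^ 2 / (2 * ν) ≤ e w' := by
    intro w'
    have h2 := (moreau_convexOn hν hl hconv he).2 (Set.mem_univ w')
      (Set.mem_univ ((2 : ℝ) • w - w')) (show (0 : ℝ) ≤ 1 / 2 by norm_num)
      (show (0 : ℝ) ≤ 1 / 2 by norm_num) (by norm_num)
    rw [show (1 / 2 : ℝ) • w' + (1 / 2 : ℝ) • ((2 : ℝ) • w - w') = w by module] at h2
    have h3 := upper ((2 : ℝ) • w - w')
    rw [show (2 : ℝ) • w - w' - w = -(w' - w) by module, inner_neg_right, norm_neg] at h3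
    simp only [smul_eq_mul] at h2
    linarith
  refine HasFDerivAt.differentiableAt (f' := innerSL ℝ s) ?_
  rw [hasFDerivAt_iff_isLittleO]
  have hO : (fun w' => e w' - e w - innerSL ℝ s (w' - w)) =O[nhds w]
      fun w' => ‖w' - w‖ ^ 2 := by
    refine Asymptotics.IsBigO.of_bound (1 / (2 * ν)) (Filter.Eventually.of_forall fun w' => ?_)
    rw [innerSL_apply_apply, Real.norm_eq_abs, abs_le, norm_pow, norm_norm]
    have h2 := upper w'
    have h3 := lower w'
    have h4 : 1 / (2 * ν) * ‖w' - w‖ ^ 2 = ‖w' - w‖ ^ 2 / (2 * ν) := by ring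
    constructor <;> linarith
  exact hO.trans_isLittleO (Asymptotics.isLittleO_pow_sub_sub w one_lt_two)

/-- First-order (descent) estimate for a map with Lipschitz derivative. -/
theorem norm_sub_linearization_le {V W : Type*} [NormedAddCommGroup V] [NormedSpace ℝ V]
    [NormedAddCommGroup W] [NormedSpace ℝ W] {c : V → W} {L : ℝ}
    (hc : Differentiable ℝ c)
    (hL : ∀ x y, ‖fderiv ℝ c x - fderiv ℝ c y‖ ≤ L * ‖x - y‖) (x u : V) :
    ‖c u - (c x + fderiv ℝ c x (u - x))‖ ≤ L / 2 * ‖u - x‖ ^ 2 := by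
  set G : ℝ → W := fun t => c (x + t • (u - x)) - c x - t • fderiv ℝ c x (u - x) with hG
  have hGd : ∀ t, HasDerivAt G ((fderiv ℝ c (x + t • (u - x)) - fderiv ℝ c x) (u - x)) t := by
    intro t
    have h1 : HasDerivAt (fun t : ℝ => x + t • (u - x)) (u - x) t := by
      simpa using ((hasDerivAt_id t).smul_const (u - x)).const_add x
    have h2 := (hc (x + t • (u - x))).hasFDerivAt.comp_hasDerivAt t h1
    have h3 : HasDerivAt (fun t : ℝ => t • fderiv ℝ c x (u - x)) (fderiv ℝ c x (u - x)) t := by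
      simpa using (hasDerivAt_id t).smul_const (fderiv ℝ c x (u - x))
    rw [sub_apply]
    exact (h2.sub_const (c x)).sub h3
  have key := image_norm_le_of_norm_deriv_right_le_deriv_boundary (f := G) (a := 0) (b := 1)
    (B := fun t => L / 2 * ‖u - x‖ ^ 2 * t ^ 2) (B' := fun t => L * ‖u - x‖ ^ 2 * t)
    (fun t _ => (hGd t).continuousAt.continuousWithinAt)
    (fun t _ => (hGd t).hasDerivWithinAt) (by simp [hG])
    (fun t => by
      have := ((hasDerivAt_id t).pow 2).const_mul (L / 2 * ‖u - x‖ ^ 2)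
      refine this.congr_deriv ?_
      simp
      ring)
    (fun t ht => by
      refine (ContinuousLinearMap.le_opNorm _ _).trans ?_
      have := hL (x + t • (u - x)) x
      rw [add_sub_cancel_left, norm_smul, Real.norm_of_nonneg ht.1] at this
      calc _ ≤ L * (t * ‖u - x‖) * ‖u - x‖ := by gcongr
        _ = _ := by ring)
  have h1 := key (Set.right_mem_Icc.2 zero_le_one)
  simp only [hG, one_smul, add_sub_cancel, one_pow, mul_one] at h1
  rwa [← sub_sub]

/-- A differentiable convex function lies above its tangent planes. -/
theorem ConvexOn.add_inner_gradient_le {V : Type*} [NormedAddCommGroup V]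
    [InnerProductSpace ℝ V] [CompleteSpace V] {φ : V → ℝ} (hφ : ConvexOn ℝ Set.univ φ) {x : V}
    (hd : DifferentiableAt ℝ φ x) (u : V) : φ x + ⟪gradient φ x, u - x⟫ ≤ φ u := by
  have h1 : ConvexOn ℝ Set.univ (φ ∘ AffineMap.lineMap (k := ℝ) x u) := by
    simpa using hφ.comp_affineMap (AffineMap.lineMap (k := ℝ) x u)
  have h2 : HasDerivAt (φ ∘ AffineMap.lineMap (k := ℝ) x u) (fderiv ℝ φ x (u - x)) 0 := by
    have h3 : HasDerivAt (AffineMap.lineMap (k := ℝ) x u) (u - x) (0 : ℝ) :=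
      AffineMap.hasDerivAt_lineMap
    have h4 : HasFDerivAt φ (fderiv ℝ φ x) (AffineMap.lineMap (k := ℝ) x u (0 : ℝ)) := by
      simpa using hd.hasFDerivAt
    exact h4.comp_hasDerivAt 0 h3
  have h3 := h1.le_slope_of_hasDerivAt (Set.mem_univ 0) (Set.mem_univ 1) zero_lt_one h2
  simp only [slope_def_field, Function.comp, AffineMap.lineMap_apply_zero,
    AffineMap.lineMap_apply_one, sub_zero, div_one] at h3
  rw [gradient, InnerProductSpace.toDual_symm_apply]
  linarith

theorem norm_gradient_le_of_lipschitz {V : Type*} [NormedAddCommGroup V]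
    [InnerProductSpace ℝ V] [CompleteSpace V] {φ : V → ℝ} {C : ℝ} (hC : 0 ≤ C)
    (hφ : ∀ u w, |φ u - φ w| ≤ C * ‖u - w‖) (x : V) : ‖gradient φ x‖ ≤ C := by
  rw [gradient, LinearIsometryEquiv.norm_map]
  refine norm_fderiv_le_of_lip' ℝ hC (Filter.Eventually.of_forall fun u => ?_)
  exact hφ u x

theorem closedBall_subset_of_le_infDist_frontier {E : Type*} [NormedAddCommGroup E]
    [NormedSpace ℝ E] [FiniteDimensional ℝ E] {X : Set E} (hX : IsClosed X) {x : E} (hx : x ∈ X)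
    {r : ℝ} (hr : 0 < r) (hrX : r ≤ infDist x (frontier X)) : closedBall x r ⊆ X := by
  rw [← closure_ball x hr.ne']
  refine closure_minimal (fun u hu => ?_) hX
  by_contra huX
  obtain ⟨w, hw, hxw⟩ := exists_mem_frontier_infDist_compl_eq_dist hx
    (fun h => huX (h ▸ Set.mem_univ u))
  have h1 := infDist_le_dist_of_mem (x := x) hw
  have h2 : infDist x Xᶜ ≤ dist x u := infDist_le_dist_of_mem huX
  rw [mem_ball'] at hu
  linarith

/-- On the range of `A`, the adjoint is bounded below by the square root of the smallest positive
eigenvalue of `A Aᵀ`. -/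
theorem sq_norm_adjoint_ge_of_mem_range {E F : Type*} [NormedAddCommGroup E]
    [InnerProductSpace ℝ E] [CompleteSpace E] [NormedAddCommGroup F] [InnerProductSpace ℝ F]
    [FiniteDimensional ℝ F] [CompleteSpace F] (A : E →L[ℝ] F) {lam : ℝ}
    (hlam : lam = sInf {μ : ℝ | 0 < μ ∧ ∃ w : F, w ≠ 0 ∧
        A (ContinuousLinearMap.adjoint A w) = μ • w}) (w : E) :
    lam * ‖A w‖ ^ 2 ≤ ‖ContinuousLinearMap.adjoint A (A w)‖ ^ 2 := by
  set T : F →ₗ[ℝ] F := (A.comp (ContinuousLinearMap.adjoint A)).toLinearMap with hT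
  have hTapp : ∀ v, T v = A (ContinuousLinearMap.adjoint A v) := fun v => rfl
  have hinner : ∀ u v, ⟪T u, v⟫
      = ⟪ContinuousLinearMap.adjoint A u, ContinuousLinearMap.adjoint A v⟫ := fun u v => by
    rw [hTapp, ← ContinuousLinearMap.adjoint_inner_right]
  have hsymm : T.IsSymmetric := fun u v => by
    rw [hinner, real_inner_comm, ← hinner, real_inner_comm]
  set e := hsymm.eigenvectorBasis rfl with he
  set μ := hsymm.eigenvalues rfl with hμ
  have heig : ∀ i, T (e i) = μ i • e i := fun i => hsymm.apply_eigenvectorBasis rfl i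
  have hμeq : ∀ i, ‖ContinuousLinearMap.adjoint A (e i)‖ ^ 2 = μ i := fun i => by
    rw [← real_inner_self_eq_norm_sq, ← hinner, heig, real_inner_smul_left,
      real_inner_self_eq_norm_sq, e.orthonormal.1 i]
    ring
  have hμnn : ∀ i, 0 ≤ μ i := fun i => by rw [← hμeq]; positivity
  rw [← real_inner_self_eq_norm_sq (ContinuousLinearMap.adjoint A (A w)), ← hinner,
    ← e.sum_inner_mul_inner (T (A w)) (A w),
    ← e.sum_sq_norm_inner_right (A w), Finset.mul_sum]
  refine Finset.sum_le_sum fun i _ => ?_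
  have h1 : ⟪T (A w), e i⟫ = μ i * ⟪e i, A w⟫ := by
    rw [hsymm, heig, real_inner_smul_right, real_inner_comm]
  rw [h1, Real.norm_eq_abs, sq_abs, mul_assoc, ← sq]
  rcases (hμnn i).eq_or_lt with h0 | hpos
  · have h2 : ContinuousLinearMap.adjoint A (e i) = 0 := by
      have := hμeq i
      rw [← h0] at this
      simpa using this
    have h3 : ⟪e i, A w⟫ = 0 := by
      rw [← ContinuousLinearMap.adjoint_inner_left, h2, inner_zero_left]
    simp [h3]
  · refine mul_le_mul_of_nonneg_right ?_ (sq_nonneg _)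
    rw [hlam]
    refine csInf_le ⟨0, fun _ h => h.1.le⟩ ⟨hpos, e i, ?_, heig i⟩
    exact norm_ne_zero_iff.1 (by rw [e.orthonormal.1 i]; exact one_ne_zero)

theorem sInf_pos_eigenvalues_pos {E F : Type*} [NormedAddCommGroup E]
    [InnerProductSpace ℝ E] [CompleteSpace E] [NormedAddCommGroup F] [InnerProductSpace ℝ F]
    [FiniteDimensional ℝ F] [CompleteSpace F] (A : E →L[ℝ] F) (hA : A ≠ 0) :
    0 < sInf {μ : ℝ | 0 < μ ∧ ∃ w : F, w ≠ 0 ∧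
        A (ContinuousLinearMap.adjoint A w) = μ • w} := by
  set S := {μ : ℝ | 0 < μ ∧ ∃ w : F, w ≠ 0 ∧ A (ContinuousLinearMap.adjoint A w) = μ • w} with hS
  set T : F →ₗ[ℝ] F := (A.comp (ContinuousLinearMap.adjoint A)).toLinearMap with hT
  have hTapp : ∀ v, T v = A (ContinuousLinearMap.adjoint A v) := fun v => rfl
  have hinner : ∀ u v, ⟪T u, v⟫
      = ⟪ContinuousLinearMap.adjoint A u, ContinuousLinearMap.adjoint A v⟫ := fun u v => by
    rw [hTapp, ← ContinuousLinearMap.adjoint_inner_right]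
  have hsymm : T.IsSymmetric := fun u v => by
    rw [hinner, real_inner_comm, ← hinner, real_inner_comm]
  have hfin : S.Finite := by
    refine (Module.End.finite_hasEigenvalue T).subset ?_
    rintro μ ⟨-, w, hw, hTw⟩
    exact Module.End.hasEigenvalue_of_hasEigenvector
      ⟨Module.End.mem_eigenspace_iff.2 hTw, hw⟩
  have hne : S.Nonempty := by
    by_contra hempty
    apply hA
    set e := hsymm.eigenvectorBasis rfl with he
    have h1 : ∀ i, ContinuousLinearMap.adjoint A (e i) = 0 := by
      intro i
      have heig : T (e i) = hsymm.eigenvalues rfl i • e i := hsymm.apply_eigenvectorBasis rfl i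
      have h2 : ‖ContinuousLinearMap.adjoint A (e i)‖ ^ 2 = hsymm.eigenvalues rfl i := by
        rw [← real_inner_self_eq_norm_sq, ← hinner, heig, real_inner_smul_left,
          real_inner_self_eq_norm_sq, e.orthonormal.1 i]
        ring
      by_contra h3
      refine hempty ⟨hsymm.eigenvalues rfl i, ?_, e i, ?_, heig⟩
      · rw [← h2]
        have := norm_pos_iff.2 h3
        positivity
      · exact norm_ne_zero_iff.1 (by rw [e.orthonormal.1 i]; exact one_ne_zero)
    have h4 : ContinuousLinearMap.adjoint A = 0 := by
      ext v
      rw [← e.sum_repr v, map_sum]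
      simp [h1]
    rw [← ContinuousLinearMap.adjoint_adjoint A, h4, map_zero]
  exact (hne.csInf_mem hfin).1

/-- The augmented Lagrangian penalty term. -/
def augPenalty {E F ι : Type*} [NormedAddCommGroup E] [InnerProductSpace ℝ E]
    [NormedAddCommGroup F] [InnerProductSpace ℝ F] [Fintype ι] (A : E →L[ℝ] F) (b : F)
    (g : ι → E → ℝ) (β : ℝ) (y : F) (z : ι → ℝ) (u : E) : ℝ :=
  ⟪y, A u - b⟫ + β / 2 * ‖A u - b‖ ^ 2 + ∑ i, (max (z i + β * g i u) 0 ^ 2 - z i ^ 2) / (2 * β)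

/-- The gradient of the augmented Lagrangian penalty term. -/
def augPenaltyGrad {E F ι : Type*} [NormedAddCommGroup E] [InnerProductSpace ℝ E]
    [CompleteSpace E] [NormedAddCommGroup F] [InnerProductSpace ℝ F] [CompleteSpace F]
    [Fintype ι] (A : E →L[ℝ] F) (b : F)
    (g : ι → E → ℝ) (β : ℝ) (y : F) (z : ι → ℝ) (u : E) : E :=
  ContinuousLinearMap.adjoint A (y + β • (A u - b))
    + ∑ i, max (z i + β * g i u) 0 • gradient (g i) u

theorem max_sq_gradient_ineq {β z r s : ℝ} (hβ : 0 < β) :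
    max (z + β * r) 0 * (s - r)
      ≤ (max (z + β * s) 0 ^ 2 - z ^ 2) / (2 * β) - (max (z + β * r) 0 ^ 2 - z ^ 2) / (2 * β) := by
  rw [← sub_div, le_div_iff₀ (by positivity)]
  have h1 : s - r = ((z + β * s) - (z + β * r)) / β := by field_simp; ring
  have h2 : max (z + β * r) 0 * (s - r) * (2 * β)
      = 2 * (max (z + β * r) 0 * ((z + β * s) - (z + β * r))) := by rw [h1]; field_simp
  rw [h2]
  rcases le_total (z + β * r) 0 with h | h
  · rw [max_eq_right h]
    nlinarith [sq_nonneg (max (z + β * s) 0)]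
  · rw [max_eq_left h]
    nlinarith [sq_nonneg (max (z + β * s) 0 - (z + β * r)), le_max_left (z + β * s) 0,
      mul_le_mul_of_nonneg_left (le_max_left (z + β * s) 0) h]

section
variable {E F ι : Type*} [NormedAddCommGroup E] [InnerProductSpace ℝ E]
  [NormedAddCommGroup F] [InnerProductSpace ℝ F] [Fintype ι] {A : E →L[ℝ] F} {b : F} {g : ι → E → ℝ} {β : ℝ} {y : F} {z : ι → ℝ}

/-- The penalty expressed through the updated multipliers. -/
theorem augPenalty_eq (hβ : 0 < β) (u : E) :
    augPenalty A b g β y z u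
      = ((‖y + β • (A u - b)‖ ^ 2 + ∑ i, max (z i + β * g i u) 0 ^ 2)
          - (‖y‖ ^ 2 + ∑ i, z i ^ 2)) / (2 * β) := by
  unfold augPenalty
  rw [← Finset.sum_div, Finset.sum_sub_distrib, norm_add_sq_real, norm_smul,
    real_inner_smul_right, Real.norm_of_nonneg hβ.le]
  field_simp
  ring

theorem continuousOn_augPenalty {X : Set E} (hg : ∀ i, ContinuousOn (g i) X) :
    ContinuousOn (augPenalty A b g β y z) X := by
  unfold augPenalty
  refine ContinuousOn.add (Continuous.continuousOn (by fun_prop)) ?_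
  refine continuousOn_finsetSum _ fun i _ => ?_
  have := hg i
  fun_prop

/-- Infeasibility and complementarity in terms of the multiplier update. -/
theorem residual_bounds (hβ : 0 < β) (hz : ∀ i, 0 ≤ z i) {x : E} {B : ℝ}
    (hp : ‖y‖ ^ 2 + ∑ i, z i ^ 2 ≤ B ^ 2)
    (hpb : ‖y + β • (A x - b)‖ ^ 2 + ∑ i, max (z i + β * g i x) 0 ^ 2 ≤ B ^ 2) :
    β ^ 2 * (‖A x - b‖ ^ 2 + ∑ i, max (-(z i) / β) (g i x) ^ 2) ≤ 4 * B ^ 2 ∧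
    β ^ 2 * (‖A x - b‖ ^ 2 + ∑ i, max (g i x) 0 ^ 2) ≤ 4 * B ^ 2 ∧
    β * ∑ i, |max (z i + β * g i x) 0 * g i x| ≤ 2 * B ^ 2 := by
  set yb := y + β • (A x - b) with hyb
  set zb : ι → ℝ := fun i => max (z i + β * g i x) 0 with hzb
  have hμ : ∀ i, β * max (-(z i) / β) (g i x) = zb i - z i := fun i => by
    rw [mul_max_of_nonneg _ _ hβ.le, mul_div_cancel₀ _ hβ.ne', hzb]
    simp only
    rw [← max_sub_sub_right, max_comm]
    congr 1 <;> ring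
  have hzbn : ∀ i, 0 ≤ zb i := fun i => le_max_right _ _
  have h1 : β ^ 2 * (‖A x - b‖ ^ 2 + ∑ i, max (-(z i) / β) (g i x) ^ 2) ≤ 4 * B ^ 2 := by
    have h2 : β ^ 2 * ‖A x - b‖ ^ 2 ≤ 2 * ‖yb‖ ^ 2 + 2 * ‖y‖ ^ 2 := by
      have : β ^ 2 * ‖A x - b‖ ^ 2 = ‖yb - y‖ ^ 2 := by
        rw [hyb, add_sub_cancel_left, norm_smul, Real.norm_of_nonneg hβ.le]; ring
      rw [this]
      nlinarith [norm_sub_le yb y, norm_nonneg (yb - y), sq_nonneg (‖yb‖ - ‖y‖)]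
    have h3 : β ^ 2 * ∑ i, max (-(z i) / β) (g i x) ^ 2
        ≤ 2 * ∑ i, zb i ^ 2 + 2 * ∑ i, z i ^ 2 := by
      rw [Finset.mul_sum, Finset.mul_sum, Finset.mul_sum, ← Finset.sum_add_distrib]
      refine Finset.sum_le_sum fun i _ => ?_
      rw [← mul_pow, hμ]
      nlinarith [sq_nonneg (zb i + z i)]
    rw [mul_add]
    linarith
  refine ⟨h1, le_trans ?_ h1, ?_⟩
  · refine mul_le_mul_of_nonneg_left ?_ (sq_nonneg β)
    refine add_le_add_right (Finset.sum_le_sum fun i _ => ?_) _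
    have h2 : -(z i) / β ≤ 0 := div_nonpos_of_nonpos_of_nonneg (neg_nonpos.2 (hz i)) hβ.le
    rcases le_total (g i x) 0 with h | h
    · rw [max_eq_right h, zero_pow two_ne_zero]
      exact sq_nonneg _
    · rw [max_eq_left h, max_eq_right (h2.trans h)]
  · have h2 : ∀ i, β * |zb i * g i x| ≤ 3 / 2 * zb i ^ 2 + 1 / 2 * z i ^ 2 := fun i => by
      rw [show β * |zb i * g i x| = |β * (zb i * g i x)| by rw [abs_mul β, abs_of_pos hβ]]
      rcases le_total (z i + β * g i x) 0 with h | h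
      · have : zb i = 0 := max_eq_right h
        rw [this]
        simp
        positivity
      · have h3 : β * (zb i * g i x) = zb i * (zb i - z i) := by
          have : zb i = z i + β * g i x := max_eq_left h
          rw [this]; ring
        rw [h3, abs_le]
        constructor <;> nlinarith [sq_nonneg (zb i - z i), sq_nonneg (zb i + z i)]
    rw [Finset.mul_sum]
    refine (Finset.sum_le_sum fun i _ => h2 i).trans ?_
    rw [Finset.sum_add_distrib, ← Finset.mul_sum, ← Finset.mul_sum]
    nlinarith [sq_nonneg ‖yb‖, sq_nonneg ‖y‖]

variable [CompleteSpace E] [CompleteSpace F]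

theorem augPenalty_gradient_ineq (hβ : 0 < β) (hg : ∀ i, ConvexOn ℝ Set.univ (g i)) {x : E}
    (hd : ∀ i, DifferentiableAt ℝ (g i) x) (u : E) :
    augPenalty A b g β y z x + ⟪augPenaltyGrad A b g β y z x, u - x⟫
      ≤ augPenalty A b g β y z u := by
  have h1 : ∀ i, max (z i + β * g i x) 0 * ⟪gradient (g i) x, u - x⟫ ≤
      (max (z i + β * g i u) 0 ^ 2 - z i ^ 2) / (2 * β)
        - (max (z i + β * g i x) 0 ^ 2 - z i ^ 2) / (2 * β) := fun i => by
    refine le_trans (mul_le_mul_of_nonneg_left ?_ (le_max_right _ _)) (max_sq_gradient_ineq hβ)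
    have := (hg i).add_inner_gradient_le (hd i) u
    linarith
  have h2 := Finset.sum_le_sum fun i (_ : i ∈ Finset.univ) => h1 i
  rw [Finset.sum_sub_distrib] at h2
  have h3 : A u - b = (A x - b) + A (u - x) := by rw [map_sub]; abel
  have h4 : ‖A u - b‖ ^ 2 = ‖A x - b‖ ^ 2 + 2 * ⟪A x - b, A (u - x)⟫ + ‖A (u - x)‖ ^ 2 := by
    rw [h3, norm_add_sq_real]
  have h5 : ⟪y, A u - b⟫ = ⟪y, A x - b⟫ + ⟪y, A (u - x)⟫ := by rw [h3, inner_add_right]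
  unfold augPenalty augPenaltyGrad
  rw [inner_add_left, ContinuousLinearMap.adjoint_inner_left, sum_inner, inner_add_left,
    real_inner_smul_left, h4, h5]
  simp only [real_inner_smul_left]
  nlinarith [sq_nonneg ‖A (u - x)‖]

theorem continuousOn_augPenaltyGrad {X : Set E} (hg : ∀ i, ContinuousOn (g i) X)
    (hg' : ∀ i, ContinuousOn (gradient (g i)) X) :
    ContinuousOn (augPenaltyGrad A b g β y z) X := by
  unfold augPenaltyGrad
  refine ContinuousOn.add (Continuous.continuousOn (by fun_prop)) ?_
  refine continuousOn_finsetSum _ fun i _ => ?_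
  have := hg i
  have := hg' i
  fun_prop

/-- A Slater-type point bounds the updated multipliers at an (approximately) stationary point. -/
theorem multiplier_bound (hβ : 0 < β) (hg : ∀ i, ConvexOn ℝ Set.univ (g i)) {x u : E}
    (hd : ∀ i, DifferentiableAt ℝ (g i) x) {κ R B : ℝ} (hκ : 0 < κ) (hB : 0 ≤ B)
    (hR : ⟪augPenaltyGrad A b g β y z x, x - u⟫ ≤ R) (hgu : ∀ i, g i u ≤ -κ)
    (hAu : κ * ‖y + β • (A x - b)‖ ≤ ⟪y + β • (A x - b), b - A u⟫)
    (hp : ‖y‖ ^ 2 + ∑ i, z i ^ 2 ≤ B ^ 2) (hRB : R ≤ κ * B) :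
    ‖y + β • (A x - b)‖ ^ 2 + ∑ i, max (z i + β * g i x) 0 ^ 2 ≤ B ^ 2 := by
  set yb := y + β • (A x - b) with hyb
  set zb : ι → ℝ := fun i => max (z i + β * g i x) 0 with hzb
  have hzbn : ∀ i, 0 ≤ zb i := fun i => le_max_right _ _
  have h1 : ∀ i, zb i * κ + (zb i ^ 2 - z i ^ 2) / (2 * β)
      ≤ zb i * ⟪gradient (g i) x, x - u⟫ := fun i => by
    have h2 := (hg i).add_inner_gradient_le (hd i) u
    rw [← neg_sub x u, inner_neg_right] at h2
    have h3 : g i x + κ ≤ ⟪gradient (g i) x, x - u⟫ := by linarith [hgu i]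
    have h4 : (zb i ^ 2 - z i ^ 2) / (2 * β) ≤ zb i * g i x := by
      rw [div_le_iff₀ (by positivity)]
      have h5 : zb i * (z i + β * g i x) = zb i ^ 2 := by
        simp only [hzb]
        rcases le_total (z i + β * g i x) 0 with h | h
        · simp [max_eq_right h]
        · rw [max_eq_left h]; ring
      nlinarith [sq_nonneg (zb i - z i)]
    nlinarith [mul_le_mul_of_nonneg_left h3 (hzbn i)]
  have h2 := Finset.sum_le_sum fun i (_ : i ∈ Finset.univ) => h1 i
  rw [Finset.sum_add_distrib, ← Finset.sum_mul, ← Finset.sum_div, Finset.sum_sub_distrib] at h2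
  have h3 : (‖yb‖ ^ 2 - ‖y‖ ^ 2) / (2 * β) ≤ ⟪yb, A x - b⟫ := by
    have h4 : A x - b = β⁻¹ • (yb - y) := by
      rw [hyb, add_sub_cancel_left, smul_smul, inv_mul_cancel₀ hβ.ne', one_smul]
    rw [h4, real_inner_smul_right, inner_sub_right, real_inner_self_eq_norm_sq,
      div_le_iff₀ (by positivity)]
    have h5 := real_inner_le_norm yb y
    have h6 : β⁻¹ * (‖yb‖ ^ 2 - ⟪yb, y⟫) * (2 * β) = 2 * (‖yb‖ ^ 2 - ⟪yb, y⟫) := by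
      field_simp
    rw [h6]
    nlinarith [sq_nonneg (‖yb‖ - ‖y‖)]
  have h4 : ⟪augPenaltyGrad A b g β y z x, x - u⟫
      = ⟪yb, A x - b⟫ + ⟪yb, b - A u⟫ + ∑ i, zb i * ⟪gradient (g i) x, x - u⟫ := by
    unfold augPenaltyGrad
    rw [inner_add_left, ContinuousLinearMap.adjoint_inner_left, sum_inner, ← inner_add_right,
      sub_add_sub_cancel, map_sub]
    simp only [real_inner_smul_left, hzb, hyb]
  have hS : 0 ≤ ∑ i, zb i := Finset.sum_nonneg fun i _ => hzbn i
  have hsq : ∑ i, zb i ^ 2 ≤ (∑ i, zb i) ^ 2 :=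
    Finset.sum_sq_le_sq_sum_of_nonneg fun i _ => hzbn i
  have hmain : ((‖yb‖ ^ 2 + ∑ i, zb i ^ 2) - (‖y‖ ^ 2 + ∑ i, z i ^ 2)) / (2 * β)
      + κ * (‖yb‖ + ∑ i, zb i) ≤ R := by
    have h5 : ((‖yb‖ ^ 2 + ∑ i, zb i ^ 2) - (‖y‖ ^ 2 + ∑ i, z i ^ 2)) / (2 * β)
      = (‖yb‖ ^ 2 - ‖y‖ ^ 2) / (2 * β) + (∑ i, zb i ^ 2 - ∑ i, z i ^ 2) / (2 * β) := by ring
    rw [h5]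
    linarith
  by_contra hcon
  rw [not_le] at hcon
  have h6 : 0 < ((‖yb‖ ^ 2 + ∑ i, zb i ^ 2) - (‖y‖ ^ 2 + ∑ i, z i ^ 2)) / (2 * β) :=
    div_pos (by linarith) (by positivity)
  have h7 : ‖yb‖ + ∑ i, zb i < B := by
    by_contra h8
    rw [not_lt] at h8
    nlinarith [mul_le_mul_of_nonneg_left h8 hκ.le]
  nlinarith [norm_nonneg yb]

end

theorem mem_wsubdiff_iff {E : Type*} [NormedAddCommGroup E] [InnerProductSpace ℝ E]
    {X : Set E} {ρ : ℝ} {φ : E → ℝ} {x ξ : E} :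
    ξ ∈ wsubdiff X ρ φ x ↔ ∀ u ∈ X, φ x + ⟪ξ, u - x⟫ - ρ / 2 * ‖u - x‖ ^ 2 ≤ φ u := by
  refine forall₂_congr fun u _ => ?_
  have h1 : ‖u‖ ^ 2 = ‖x‖ ^ 2 + 2 * ⟪x, u - x⟫ + ‖u - x‖ ^ 2 := by
    rw [← norm_add_sq_real, add_sub_cancel]
  have h2 : ⟪ξ + ρ • x, u - x⟫ = ⟪ξ, u - x⟫ + ρ * ⟪x, u - x⟫ := by
    rw [inner_add_left, real_inner_smul_left]
  show φ x + ρ / 2 * ‖x‖ ^ 2 + ⟪ξ + ρ • x, u - x⟫ ≤ φ u + ρ / 2 * ‖u‖ ^ 2 ↔ _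
  rw [h1, h2]
  constructor <;> intro h <;> linarith

/-- A lower semicontinuous function whose subgradients are bounded modulo the normal cone is
Lipschitz. -/
theorem sub_le_of_csubdiff_subset {E : Type*} [NormedAddCommGroup E] [InnerProductSpace ℝ E]
    {X : Set E} (hX : Convex ℝ X) {h : E → ℝ} (hlsc : LowerSemicontinuous h)
    {r : ℝ} (hne : ∀ u ∈ X, (csubdiff X h u).Nonempty)
    (hsub : ∀ u ∈ X, ∀ ξ ∈ csubdiff X h u,
      ∃ w v, ξ = w + v ∧ (∀ u' ∈ X, ⟪w, u' - u⟫ ≤ 0) ∧ ‖v‖ ≤ r)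
    {x₀ : E} (hx₀ : x₀ ∈ interior X) {u x : E} (hu : u ∈ X) (hx : x ∈ X) :
    h u - h x ≤ r * ‖u - x‖ := by
  have hint : ∀ u ∈ interior X, h u - h x ≤ r * ‖u - x‖ := by
    intro u hu
    obtain ⟨ξ, hξ⟩ := hne u (interior_subset hu)
    obtain ⟨w, v, rfl, hw, hv⟩ := hsub u (interior_subset hu) ξ hξ
    have hw0 : w = 0 := by
      obtain ⟨t, ht, hball⟩ := Metric.mem_nhds_iff.1 (mem_interior_iff_mem_nhds.1 hu)
      by_contra hne
      have hpos := norm_pos_iff.2 hne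
      have h1 := hw (u + (t / 2 / ‖w‖) • w) (hball (by
        rw [mem_ball, dist_eq_norm, add_sub_cancel_left, norm_smul, Real.norm_of_nonneg
          (by positivity), div_mul_cancel₀ _ hpos.ne']
        linarith))
      rw [add_sub_cancel_left, real_inner_smul_right, real_inner_self_eq_norm_sq] at h1
      have : 0 < t / 2 / ‖w‖ * ‖w‖ ^ 2 := by positivity
      linarith
    have h1 := hξ x hx
    rw [hw0, zero_add] at h1
    have h2 := real_inner_le_norm v (u - x)
    rw [← neg_sub u x, inner_neg_right] at h1
    have h3 := mul_le_mul_of_nonneg_right hv (norm_nonneg (u - x))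
    linarith
  set q : ℝ → E := fun s => u + s • (x₀ - u) with hq
  have hq0 : Filter.Tendsto q (nhdsWithin 0 (Set.Ioi 0)) (nhds u) := by
    have : Continuous q := by fun_prop
    have := this.tendsto 0
    simp only [hq, zero_smul, add_zero] at this
    exact this.mono_left nhdsWithin_le_nhds
  refine le_of_forall_pos_le_add fun e he => ?_
  have h1 : ∀ᶠ s in nhdsWithin (0 : ℝ) (Set.Ioi 0), h u - e / 2 < h (q s) :=
    hq0.eventually (hlsc u _ (by linarith))
  have h2 : ∀ᶠ s in nhdsWithin (0 : ℝ) (Set.Ioi 0), r * ‖q s - x‖ < r * ‖u - x‖ + e / 2 := by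
    have : Filter.Tendsto (fun s => r * ‖q s - x‖) (nhdsWithin 0 (Set.Ioi 0))
        (nhds (r * ‖u - x‖)) := (hq0.sub_const x).norm.const_mul r
    exact this.eventually (gt_mem_nhds (by linarith))
  have h3 : ∀ᶠ s in nhdsWithin (0 : ℝ) (Set.Ioi 0), s ∈ Set.Ioc (0 : ℝ) 1 :=
    Ioc_mem_nhdsGT one_pos
  obtain ⟨s, hs1, hs2, hs3⟩ := (h1.and (h2.and h3)).exists
  have h4 : q s ∈ interior X := hX.add_smul_sub_mem_interior hu hx₀ hs3
  have := hint _ h4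
  linarith

section
variable {E F ι : Type*} [NormedAddCommGroup E] [InnerProductSpace ℝ E]
  [NormedAddCommGroup F] [InnerProductSpace ℝ F] [CompleteSpace E] [CompleteSpace F]
  [Fintype ι] {A : E →L[ℝ] F} {b : F} {g : ι → E → ℝ} {β : ℝ} {y : F} {z : ι → ℝ}

/-- The proximal augmented Lagrangian of a weakly convex Lipschitz function has an exact
minimizer, which is stationary. -/
theorem exists_prox_augLagrangian_minimizer {X : Set E} (hXcomp : IsCompact X)
    (hXne : X.Nonempty) {D : ℝ} (hD : ∀ u ∈ X, ∀ u' ∈ X, ‖u - u'‖ ≤ D)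
    {ρ : ℝ} (hρ : 0 < ρ) {Φ : E → ℝ} (hΦ : ConvexOn ℝ X fun u => Φ u + ρ / 2 * ‖u‖ ^ 2)
    {C : ℝ} (hC : 0 ≤ C) (hΦlip : ∀ u ∈ X, ∀ u' ∈ X, Φ u - Φ u' ≤ C * ‖u - u'‖)
    (hβ : 0 < β) (hg : ∀ i, ConvexOn ℝ Set.univ (g i))
    (hgd : ∀ i, ∀ u ∈ X, DifferentiableAt ℝ (g i) u)
    (hg' : ∀ i, ContinuousOn (gradient (g i)) X) {xb : E} (hxb : xb ∈ X) :
    ∃ xs ∈ X, -(augPenaltyGrad A b g β y z xs + (2 * ρ) • (xs - xb)) ∈ wsubdiff X ρ Φ xs ∧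
      (∀ u ∈ X, Φ xs + augPenalty A b g β y z xs + ρ * ‖xs - xb‖ ^ 2 + ρ / 2 * ‖u - xs‖ ^ 2
        ≤ Φ u + augPenalty A b g β y z u + ρ * ‖u - xb‖ ^ 2) ∧
      ∀ u ∈ X, ⟪augPenaltyGrad A b g β y z xs, xs - u⟫ ≤ D * (C + 2 * ρ * D) := by
  have hgc : ∀ i, ContinuousOn (g i) X := fun i u hu =>
    (hgd i u hu).continuousAt.continuousWithinAt
  have hΦc : ContinuousOn Φ X := by
    refine LipschitzOnWith.continuousOn (K := C.toNNReal)
      (LipschitzOnWith.of_dist_le_mul fun u hu v hv => ?_)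
    rw [Real.dist_eq, dist_eq_norm, Real.coe_toNNReal C hC, abs_le]
    have h1 := hΦlip u hu v hv
    have h2 := hΦlip v hv u hu
    rw [norm_sub_rev] at h2
    constructor <;> linarith
  set G := augPenaltyGrad A b g β y z with hG
  have hGc : ContinuousOn G X := continuousOn_augPenaltyGrad hgc hg'
  obtain ⟨xs, hxs, hmin⟩ := hXcomp.exists_isMinOn hXne
    ((hΦc.add (continuousOn_augPenalty (A := A) (b := b) (β := β) (y := y) (z := z) hgc)).add
      (Continuous.continuousOn (f := fun u => ρ * ‖u - xb‖ ^ 2) (by fun_prop)))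
  have hmem : -(G xs + (2 * ρ) • (xs - xb)) ∈ wsubdiff X ρ Φ xs := by
    rw [mem_wsubdiff_iff]
    intro u hu
    set q : ℝ → E := fun t => xs + t • (u - xs) with hq
    have hqX : ∀ t ∈ Set.Ioc (0 : ℝ) 1, q t ∈ X := fun t ht =>
      hΦ.1.add_smul_sub_mem hxs hu ⟨ht.1.le, ht.2⟩
    have key : ∀ t ∈ Set.Ioc (0 : ℝ) 1, 0 ≤ Φ u - Φ xs + ρ / 2 * (1 - t) * ‖u - xs‖ ^ 2
        + ⟪G (q t), u - xs⟫ + 2 * ρ * ⟪xs - xb, u - xs⟫ + ρ * t * ‖u - xs‖ ^ 2 := by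
      intro t ht
      have h1 : Φ xs + augPenalty A b g β y z xs + ρ * ‖xs - xb‖ ^ 2
        ≤ Φ (q t) + augPenalty A b g β y z (q t) + ρ * ‖q t - xb‖ ^ 2 := hmin (hqX t ht)
      have h2 := augPenalty_gradient_ineq (A := A) (b := b) (y := y) (z := z) hβ hg
        (fun i => hgd i _ (hqX t ht)) xs
      rw [show xs - q t = -(t • (u - xs)) by simp [hq], inner_neg_right,
        real_inner_smul_right] at h2
      have h3 : ‖q t - xb‖ ^ 2
          = ‖xs - xb‖ ^ 2 + 2 * (t * ⟪xs - xb, u - xs⟫) + t ^ 2 * ‖u - xs‖ ^ 2 := by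
        rw [show q t - xb = (xs - xb) + t • (u - xs) by simp only [hq]; abel,
          norm_add_sq_real, norm_smul, real_inner_smul_right, mul_pow, Real.norm_eq_abs, sq_abs]
      have h4 := hΦ.2 hxs hu (sub_nonneg.2 ht.2) ht.1.le (by ring)
      rw [show (1 - t) • xs + t • u = q t by simp only [hq]; module] at h4
      have h5 : ‖q t‖ ^ 2 = ‖xs‖ ^ 2 + 2 * (t * ⟪xs, u - xs⟫) + t ^ 2 * ‖u - xs‖ ^ 2 := by
        rw [hq, norm_add_sq_real, norm_smul, real_inner_smul_right, mul_pow, Real.norm_eq_abs,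
          sq_abs]
      have h6 : ‖u‖ ^ 2 = ‖xs‖ ^ 2 + 2 * ⟪xs, u - xs⟫ + ‖u - xs‖ ^ 2 := by
        rw [← norm_add_sq_real, add_sub_cancel]
      simp only [smul_eq_mul] at h4
      rw [h5, h6] at h4
      rw [h3] at h1
      have h7 : 0 ≤ t * (Φ u - Φ xs + ρ / 2 * (1 - t) * ‖u - xs‖ ^ 2
        + ⟪G (q t), u - xs⟫ + 2 * ρ * ⟪xs - xb, u - xs⟫ + ρ * t * ‖u - xs‖ ^ 2) := by
        linarith
      exact nonneg_of_mul_nonneg_right h7 ht.1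
    have hlim : Filter.Tendsto (fun t => Φ u - Φ xs + ρ / 2 * (1 - t) * ‖u - xs‖ ^ 2
        + ⟪G (q t), u - xs⟫ + 2 * ρ * ⟪xs - xb, u - xs⟫ + ρ * t * ‖u - xs‖ ^ 2)
        (nhdsWithin 0 (Set.Ioi 0))
        (nhds (Φ u - Φ xs + ρ / 2 * (1 - 0) * ‖u - xs‖ ^ 2
        + ⟪G xs, u - xs⟫ + 2 * ρ * ⟪xs - xb, u - xs⟫ + ρ * 0 * ‖u - xs‖ ^ 2)) := by
      have hid : Filter.Tendsto (fun t : ℝ => t) (nhdsWithin 0 (Set.Ioi 0)) (nhds 0) :=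
        nhdsWithin_le_nhds
      have hq0 : Filter.Tendsto q (nhdsWithin 0 (Set.Ioi 0)) (nhdsWithin xs X) := by
        refine tendsto_nhdsWithin_iff.2 ⟨?_, ?_⟩
        · have : Continuous q := by fun_prop
          have := this.tendsto 0
          simp only [hq, zero_smul, add_zero] at this
          exact this.mono_left nhdsWithin_le_nhds
        · filter_upwards [Ioc_mem_nhdsGT (one_pos (α := ℝ))] with t ht using hqX t ht
      have hGq : Filter.Tendsto (fun t => ⟪G (q t), u - xs⟫) (nhdsWithin 0 (Set.Ioi 0))
          (nhds ⟪G xs, u - xs⟫) := ((hGc xs hxs).tendsto.comp hq0).inner tendsto_const_nhds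
      exact ((((((hid.const_sub 1).const_mul (ρ / 2)).mul_const _).const_add _).add hGq).add_const
        _).add ((hid.const_mul ρ).mul_const _)
    have h0 := ge_of_tendsto hlim (by
      filter_upwards [Ioc_mem_nhdsGT (one_pos (α := ℝ))] with t ht using key t ht)
    rw [inner_neg_left, inner_add_left, real_inner_smul_left]
    linarith
  have hmem' := mem_wsubdiff_iff.1 hmem
  refine ⟨xs, hxs, hmem, fun u hu => ?_, fun u hu => ?_⟩
  · have h1 := hmem' u hu
    have h2 := augPenalty_gradient_ineq (A := A) (b := b) (y := y) (z := z) hβ hg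
      (fun i => hgd i _ hxs) u
    have h3 : ‖u - xb‖ ^ 2 = ‖xs - xb‖ ^ 2 + 2 * ⟪xs - xb, u - xs⟫ + ‖u - xs‖ ^ 2 := by
      rw [← norm_add_sq_real]
      congr 2
      abel
    rw [inner_neg_left, inner_add_left, real_inner_smul_left] at h1
    rw [h3]
    linarith
  · have h1 : ⟪-(G xs + (2 * ρ) • (xs - xb)), u - xs⟫ ≤ C * ‖u - xs‖ := by
      refine le_of_forall_pos_le_add fun e he => ?_
      set N := ρ / 2 * ‖u - xs‖ ^ 2 with hN
      have hN0 : 0 ≤ N := by positivity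
      obtain ⟨t, ht0, ht1, htN⟩ : ∃ t : ℝ, 0 < t ∧ t ≤ 1 ∧ t * N ≤ e := by
        refine ⟨min 1 (e / (N + 1)), by positivity, min_le_left _ _, ?_⟩
        calc min 1 (e / (N + 1)) * N ≤ e / (N + 1) * (N + 1) := by
              gcongr
              · exact min_le_right _ _
              · linarith
          _ = e := by field_simp
      have hqX : xs + t • (u - xs) ∈ X := hΦ.1.add_smul_sub_mem hxs hu ⟨ht0.le, ht1⟩
      have h2 := hmem' _ hqX
      have h3 := hΦlip _ hqX _ hxs
      rw [add_sub_cancel_left, norm_smul, Real.norm_of_nonneg ht0.le] at h3 h2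
      rw [real_inner_smul_right] at h2
      have h4 : t * ⟪-(G xs + (2 * ρ) • (xs - xb)), u - xs⟫ ≤ t * (C * ‖u - xs‖ + e) := by
        have h5 : ρ / 2 * (t * ‖u - xs‖) ^ 2 = t * (t * N) := by rw [hN]; ring
        have h6 := mul_le_mul_of_nonneg_left htN ht0.le
        linarith
      exact le_of_mul_le_mul_left h4 ht0
    have h2 := real_inner_le_norm (xs - xb) (u - xs)
    have h3 := hD u hu xs hxs
    have h4 := hD xs hxs xb hxb
    have h5 : ‖xs - xb‖ * ‖u - xs‖ ≤ D * D :=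
      mul_le_mul h4 h3 (norm_nonneg _) ((norm_nonneg _).trans h4)
    rw [inner_neg_left, inner_add_left, real_inner_smul_left] at h1
    rw [← neg_sub u xs, inner_neg_right]
    nlinarith [mul_le_mul_of_nonneg_left h3 hC]
end

theorem max_add_mul_sq_le {β β' z α s : ℝ} (hβ : 0 < β) (hββ : β ≤ β') :
    (max (z + α * max (-z / β) s + β' * s) 0 ^ 2 - (z + α * max (-z / β) s) ^ 2) / (2 * β')
      ≤ (max (z + β * s) 0 ^ 2 - z ^ 2) / (2 * β) + α * max (-z / β) s ^ 2
        + (β' - β) / 2 * max (-z / β) s ^ 2 := by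
  have hβ' : 0 < β' := hβ.trans_le hββ
  set μ := max (-z / β) s with hμ
  have h1 : max (z + β * s) 0 = z + β * μ := by
    rw [hμ, mul_max_of_nonneg _ _ hβ.le, ← max_add_add_left, mul_div_cancel₀ _ hβ.ne',
      add_neg_cancel, max_comm]
  have h2 : max (z + α * μ + β' * s) 0 ^ 2 ≤ (z + α * μ + β' * μ) ^ 2 := by
    have h3 : z + α * μ + β' * s ≤ z + α * μ + β' * μ := by
      gcongr
      exact le_max_right _ _
    rcases le_total (z + α * μ + β' * s) 0 with h | h
    · rw [max_eq_right h, zero_pow two_ne_zero]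
      exact sq_nonneg _
    · rw [max_eq_left h]
      exact pow_le_pow_left₀ h h3 2
  rw [h1]
  calc _ ≤ ((z + α * μ + β' * μ) ^ 2 - (z + α * μ) ^ 2) / (2 * β') := by gcongr
    _ = _ := by
      field_simp
      ring

theorem mul_max_neg_div_sq_le {β z α s : ℝ} (hβ : 0 < β) (hz : 0 ≤ z) (hα : 0 ≤ α)
    (hz' : 0 ≤ z + α * max (-z / β) s) :
    α * max (-z / β) s ^ 2 ≤ α * max s 0 ^ 2 + (z ^ 2 - (z + α * max (-z / β) s) ^ 2) / β
      + α / β * (max s 0 * (z + (z + α * max (-z / β) s))) := by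
  have h0 : -z / β ≤ 0 := div_nonpos_of_nonpos_of_nonneg (by linarith) hβ.le
  have e : ∀ w : ℝ, (z ^ 2 - (z + w) ^ 2) / β = -w * (z + (z + w)) / β := fun w => by ring
  rw [e]
  rcases le_total 0 s with hs | hs
  · rw [max_eq_left hs, max_eq_right (h0.trans hs)]
    exact (le_of_eq (by ring))
  · rw [max_eq_right hs]
    set μ := max (-z / β) s with hμ
    have hμ0 : μ ≤ 0 := max_le h0 hs
    have h1 : -μ ≤ z / β := by
      have := le_max_left (-z / β) s
      rw [← hμ, neg_div] at this
      linarith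
    have h2 : z / β ≤ (z + (z + α * μ)) / β := by gcongr; linarith
    have h3 : α * -μ * -μ ≤ α * -μ * ((z + (z + α * μ)) / β) :=
      mul_le_mul_of_nonneg_left (h1.trans h2) (mul_nonneg hα (by linarith))
    calc α * μ ^ 2 = α * -μ * -μ := by ring
      _ ≤ α * -μ * ((z + (z + α * μ)) / β) := h3
      _ = _ := by ring

section
variable {E F ι : Type*} [NormedAddCommGroup E] [InnerProductSpace ℝ E]
  [NormedAddCommGroup F] [InnerProductSpace ℝ F]
  [Fintype ι] {A : E →L[ℝ] F} {b : F} {g : ι → E → ℝ} {β : ℝ} {y : F} {z : ι → ℝ}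

theorem sum_mul_le_of_sum_sq_le {a c : ι → ℝ} {P B : ℝ} (hP : 0 ≤ P) (hB : 0 ≤ B)
    (ha : ∑ i, a i ^ 2 ≤ P ^ 2) (hc : ∑ i, c i ^ 2 ≤ B ^ 2) : ∑ i, a i * c i ≤ P * B := by
  refine abs_le_of_sq_le_sq' ?_ (by positivity) |>.2
  calc (∑ i, a i * c i) ^ 2 ≤ (∑ i, a i ^ 2) * ∑ i, c i ^ 2 :=
        Finset.sum_mul_sq_le_sq_mul_sq _ _ _
    _ ≤ P ^ 2 * B ^ 2 := by gcongr
    _ = _ := by ring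

/-- Change of the penalty term under one dual update. -/
theorem augPenalty_update_le {β' α pf v B : ℝ} {x : E} {y' : F} {z' : ι → ℝ} (hβ : 0 < β)
    (hββ : β ≤ β') (hββ2 : β' ≤ 2 * β) (hB : 0 ≤ B) (hz : ∀ i, 0 ≤ z i) (hz' : ∀ i, 0 ≤ z' i)
    (hα : 0 ≤ α)
    (hpf : pf = √(‖A x - b‖ ^ 2 + ∑ i, max (g i x) 0 ^ 2)) (hαv : α * pf ≤ v)
    (hy' : y' = y + α • (A x - b))
    (hz'u : ∀ i, z' i = z i + α * max (-(z i) / β) (g i x))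
    (hp : ‖y‖ ^ 2 + ∑ i, z i ^ 2 ≤ B ^ 2) (hp' : ‖y'‖ ^ 2 + ∑ i, z' i ^ 2 ≤ B ^ 2)
    (hpb : ‖y + β • (A x - b)‖ ^ 2 + ∑ i, max (z i + β * g i x) 0 ^ 2 ≤ B ^ 2) :
    augPenalty A b g β' y' z' x ≤ augPenalty A b g β y z x + 4 * B * v / β
      + (∑ i, z i ^ 2 - ∑ i, z' i ^ 2) / β + 4 * B ^ 2 * (1 / β - 1 / β') := by
  have hβ' : 0 < β' := hβ.trans_le hββ
  obtain ⟨h1, h2, -⟩ := residual_bounds hβ hz hp hpb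
  set r := A x - b with hr
  set μ : ι → ℝ := fun i => max (-(z i) / β) (g i x) with hμ
  have hpf2 : pf ^ 2 = ‖r‖ ^ 2 + ∑ i, max (g i x) 0 ^ 2 := by
    rw [hpf, Real.sq_sqrt (by positivity)]
  have hpf0 : 0 ≤ pf := hpf ▸ Real.sqrt_nonneg _
  have hpfB : β * pf ≤ 2 * B := by
    refine abs_le_of_sq_le_sq' ?_ (by positivity) |>.2
    rw [mul_pow, hpf2]
    linarith
  have hv : 0 ≤ v := (mul_nonneg hα hpf0).trans hαv
  have hsum1 : ∑ i, (max (z' i + β' * g i x) 0 ^ 2 - z' i ^ 2) / (2 * β')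
      ≤ ∑ i, (max (z i + β * g i x) 0 ^ 2 - z i ^ 2) / (2 * β) + α * ∑ i, μ i ^ 2
        + (β' - β) / 2 * ∑ i, μ i ^ 2 := by
    rw [Finset.mul_sum, Finset.mul_sum, ← Finset.sum_add_distrib, ← Finset.sum_add_distrib]
    refine Finset.sum_le_sum fun i _ => ?_
    rw [hz'u i]
    exact max_add_mul_sq_le hβ hββ
  have hsum2 : α * ∑ i, μ i ^ 2 ≤ α * ∑ i, max (g i x) 0 ^ 2
      + (∑ i, z i ^ 2 - ∑ i, z' i ^ 2) / β
      + α / β * ∑ i, max (g i x) 0 * (z i + z' i) := by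
    rw [Finset.mul_sum, Finset.mul_sum, ← Finset.sum_sub_distrib, Finset.sum_div,
      Finset.mul_sum, ← Finset.sum_add_distrib, ← Finset.sum_add_distrib]
    refine Finset.sum_le_sum fun i _ => ?_
    have h3 := hz' i
    rw [hz'u i] at h3 ⊢
    exact mul_max_neg_div_sq_le hβ (hz i) hα h3
  have hgp : ∑ i, max (g i x) 0 ^ 2 ≤ pf ^ 2 := by
    rw [hpf2]
    linarith [sq_nonneg ‖r‖]
  have hcs : ∑ i, max (g i x) 0 * (z i + z' i) ≤ pf * (2 * B) := by
    have h3 := sum_mul_le_of_sum_sq_le hpf0 hB hgp (c := z) (by linarith [sq_nonneg ‖y‖])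
    have h4 := sum_mul_le_of_sum_sq_le hpf0 hB hgp (c := z') (by linarith [sq_nonneg ‖y'‖])
    simp only [mul_add, Finset.sum_add_distrib]
    linarith
  have hmid : α / β * ∑ i, max (g i x) 0 * (z i + z' i) ≤ 2 * B * v / β := by
    calc _ ≤ α / β * (pf * (2 * B)) := by gcongr
      _ = 2 * B * (α * pf) / β := by ring
      _ ≤ _ := by gcongr
  have hmid2 : α * ‖r‖ ^ 2 + α * ∑ i, max (g i x) 0 ^ 2 ≤ 2 * B * v / β := by
    rw [← mul_add, ← hpf2, le_div_iff₀ hβ]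
    calc α * pf ^ 2 * β = (α * pf) * (β * pf) := by ring
      _ ≤ v * (2 * B) := by gcongr
      _ = _ := by ring
  have hlast : (β' - β) / 2 * ‖r‖ ^ 2 + (β' - β) / 2 * ∑ i, μ i ^ 2
      ≤ 4 * B ^ 2 * (1 / β - 1 / β') := by
    rw [← mul_add]
    have h5 : ‖r‖ ^ 2 + ∑ i, μ i ^ 2 ≤ 4 * B ^ 2 / β ^ 2 := by
      rw [le_div_iff₀ (by positivity)]
      linarith
    calc _ ≤ (β' - β) / 2 * (4 * B ^ 2 / β ^ 2) := by
          have : 0 ≤ β' - β := by linarith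
          gcongr
      _ = 4 * B ^ 2 * (β' - β) / (β * (2 * β)) := by field_simp
      _ ≤ 4 * B ^ 2 * (β' - β) / (β * β') := by
          have : 0 ≤ β' - β := by linarith
          gcongr
      _ = _ := by field_simp
  have hy'' : ⟪y', r⟫ + β' / 2 * ‖r‖ ^ 2
      = ⟪y, r⟫ + β / 2 * ‖r‖ ^ 2 + α * ‖r‖ ^ 2 + (β' - β) / 2 * ‖r‖ ^ 2 := by
    rw [hy', inner_add_left, real_inner_smul_left, real_inner_self_eq_norm_sq]
    ring
  unfold augPenalty
  rw [← hr, hy'']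
  have : 4 * B * v / β = 2 * B * v / β + 2 * B * v / β := by ring
  linarith

/-- The multiplier update is a convex combination of the old and the full-step multipliers. -/
theorem multiplier_update_bound {α B : ℝ} {x : E} {y' : F} {z' : ι → ℝ} (hβ : 0 < β)
    (hα : 0 ≤ α) (hαβ : α ≤ β) (hz : ∀ i, 0 ≤ z i)
    (hy' : y' = y + α • (A x - b))
    (hz'u : ∀ i, z' i = z i + α * max (-(z i) / β) (g i x))
    (hp : ‖y‖ ^ 2 + ∑ i, z i ^ 2 ≤ B ^ 2)
    (hpb : ‖y + β • (A x - b)‖ ^ 2 + ∑ i, max (z i + β * g i x) 0 ^ 2 ≤ B ^ 2) :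
    ‖y'‖ ^ 2 + ∑ i, z' i ^ 2 ≤ B ^ 2 ∧ ∀ i, 0 ≤ z' i := by
  obtain ⟨t, ht0, ht1, rfl⟩ : ∃ t, 0 ≤ t ∧ t ≤ 1 ∧ α = t * β :=
    ⟨α / β, by positivity, (div_le_one hβ).2 hαβ, by field_simp⟩
  have hz2 : ∀ i, z' i = (1 - t) * z i + t * max (z i + β * g i x) 0 := by
    intro i
    have h1 : max (z i + β * g i x) 0 = z i + β * max (-(z i) / β) (g i x) := by
      rw [mul_max_of_nonneg _ _ hβ.le, ← max_add_add_left, mul_div_cancel₀ _ hβ.ne',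
        add_neg_cancel, max_comm]
    rw [hz'u, h1]
    ring
  have hsq : ∀ a c : ℝ, ((1 - t) * a + t * c) ^ 2 ≤ (1 - t) * a ^ 2 + t * c ^ 2 := by
    intro a c
    nlinarith [mul_nonneg (mul_nonneg ht0 (sub_nonneg.2 ht1)) (sq_nonneg (a - c))]
  refine ⟨?_, fun i => ?_⟩
  · have h1 : ‖y'‖ ^ 2 ≤ (1 - t) * ‖y‖ ^ 2 + t * ‖y + β • (A x - b)‖ ^ 2 := by
      have : y' = (1 - t) • y + t • (y + β • (A x - b)) := by rw [hy']; module
      rw [this]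
      refine le_trans ?_ (hsq _ _)
      gcongr
      refine (norm_add_le _ _).trans_eq ?_
      rw [norm_smul, norm_smul, Real.norm_of_nonneg ht0, Real.norm_of_nonneg (sub_nonneg.2 ht1)]
    have h2 : ∑ i, z' i ^ 2
        ≤ (1 - t) * ∑ i, z i ^ 2 + t * ∑ i, max (z i + β * g i x) 0 ^ 2 := by
      rw [Finset.mul_sum, Finset.mul_sum, ← Finset.sum_add_distrib]
      refine Finset.sum_le_sum fun i _ => ?_
      rw [hz2]
      exact hsq _ _
    nlinarith [mul_le_mul_of_nonneg_left hp (sub_nonneg.2 ht1), mul_le_mul_of_nonneg_left hpb ht0]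
  · rw [hz2]
    have := mul_nonneg (sub_nonneg.2 ht1) (hz i)
    have := mul_nonneg ht0 (le_max_right (z i + β * g i x) 0)
    linarith

theorem neg_le_augPenalty {B : ℝ} (hβ : 0 < β) (hp : ‖y‖ ^ 2 + ∑ i, z i ^ 2 ≤ B ^ 2) (u : E) :
    -(B ^ 2 / (2 * β)) ≤ augPenalty A b g β y z u := by
  rw [augPenalty_eq hβ, ← neg_div]
  have : 0 ≤ ‖y + β • (A u - b)‖ ^ 2 + ∑ i, max (z i + β * g i u) 0 ^ 2 := by positivity
  gcongr
  linarith

theorem augPenalty_le {B pf : ℝ} {u : E} (hβ : 0 < β) (hB : 0 ≤ B) (hz : ∀ i, 0 ≤ z i)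
    (hp : ‖y‖ ^ 2 + ∑ i, z i ^ 2 ≤ B ^ 2) (hpf0 : 0 ≤ pf)
    (hpf : ‖A u - b‖ ^ 2 + ∑ i, max (g i u) 0 ^ 2 ≤ pf ^ 2) :
    augPenalty A b g β y z u ≤ 2 * B * pf + β / 2 * pf ^ 2 := by
  have hsc : ∀ i, (max (z i + β * g i u) 0 ^ 2 - z i ^ 2) / (2 * β)
      ≤ max (g i u) 0 * z i + β / 2 * max (g i u) 0 ^ 2 := by
    intro i
    have h1 : max (z i + β * g i u) 0 ≤ z i + β * max (g i u) 0 := by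
      have h3 := hz i
      have h4 : 0 ≤ max (g i u) 0 := le_max_right _ _
      refine max_le ?_ (by positivity)
      gcongr
      exact le_max_left _ _
    calc _ ≤ ((z i + β * max (g i u) 0) ^ 2 - z i ^ 2) / (2 * β) := by
          gcongr
      _ = _ := by field_simp; ring
  have h1 : ∑ i, (max (z i + β * g i u) 0 ^ 2 - z i ^ 2) / (2 * β)
      ≤ ∑ i, max (g i u) 0 * z i + β / 2 * ∑ i, max (g i u) 0 ^ 2 := by
    rw [Finset.mul_sum, ← Finset.sum_add_distrib]
    exact Finset.sum_le_sum fun i _ => hsc i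
  have h2 : ∑ i, max (g i u) 0 * z i ≤ pf * B :=
    sum_mul_le_of_sum_sq_le hpf0 hB (by linarith [sq_nonneg ‖A u - b‖])
      (by linarith [sq_nonneg ‖y‖])
  have h3 : ⟪y, A u - b⟫ ≤ B * pf := by
    have hz2 : 0 ≤ ∑ i, z i ^ 2 := by positivity
    have hg2 : 0 ≤ ∑ i, max (g i u) 0 ^ 2 := by positivity
    have h4 : ‖y‖ ≤ B := abs_le_of_sq_le_sq' (by linarith) hB |>.2
    have h5 : ‖A u - b‖ ≤ pf := abs_le_of_sq_le_sq' (by linarith) hpf0 |>.2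
    exact (real_inner_le_norm _ _).trans (mul_le_mul h4 h5 (norm_nonneg _) hB)
  unfold augPenalty
  have h6 := mul_le_mul_of_nonneg_left hpf (by positivity : 0 ≤ β / 2)
  linarith
end

theorem isClosed_csubdiff {E : Type*} [NormedAddCommGroup E] [InnerProductSpace ℝ E]
    (X : Set E) (φ : E → ℝ) (x : E) : IsClosed (csubdiff X φ x) := by
  have : csubdiff X φ x = ⋂ u ∈ X, {ξ | φ x + ⟪ξ, u - x⟫ ≤ φ u} := by
    ext ξ
    simp [csubdiff]
  rw [this]
  exact isClosed_biInter fun u _ => isClosed_le (by fun_prop) continuous_const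

theorem exists_norm_le_of_infDist_le {E : Type*} [NormedAddCommGroup E] [ProperSpace E]
    {S : Set E} (hS : IsClosed S) (hne : S.Nonempty) {a₁ a₂ a₃ a₄ : E} {e : ℝ}
    (h : infDist 0 {w | ∃ ξ ∈ S, w = a₁ + ξ + a₂ + a₃ + a₄} ≤ e) :
    ∃ ξ ∈ S, ‖a₁ + ξ + a₂ + a₃ + a₄‖ ≤ e := by
  have hT : {w | ∃ ξ ∈ S, w = a₁ + ξ + a₂ + a₃ + a₄}
      = (fun w => w - (a₁ + a₂ + a₃ + a₄)) ⁻¹' S := by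
    ext w
    constructor
    · rintro ⟨ξ, hξ, rfl⟩
      simpa [show a₁ + ξ + a₂ + a₃ + a₄ - (a₁ + a₂ + a₃ + a₄) = ξ by abel] using hξ
    · intro hw
      exact ⟨w - (a₁ + a₂ + a₃ + a₄), hw, by abel⟩
  have hcl : IsClosed {w | ∃ ξ ∈ S, w = a₁ + ξ + a₂ + a₃ + a₄} := by
    rw [hT]
    exact hS.preimage (by fun_prop)
  obtain ⟨ξ₀, hξ₀⟩ := hne
  obtain ⟨w, ⟨ξ, hξ, rfl⟩, hw⟩ := hcl.exists_infDist_eq_dist ⟨_, ξ₀, hξ₀, rfl⟩ 0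
  refine ⟨ξ, hξ, ?_⟩
  rwa [hw, dist_zero_left] at h

section
variable {E F ι : Type*} [NormedAddCommGroup E] [InnerProductSpace ℝ E]
  [NormedAddCommGroup F] [InnerProductSpace ℝ F] [CompleteSpace E] [CompleteSpace F]
  [Fintype ι] {A : E →L[ℝ] F} {b : F} {g : ι → E → ℝ} {β : ℝ} {y : F} {z : ι → ℝ}

theorem inexact_stationary_growth {X : Set E} {h φ : E → ℝ} {x xb ξ : E} {ρ e : ℝ}
    (hφ : ConvexOn ℝ Set.univ φ) (hφd : DifferentiableAt ℝ φ x)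
    (hβ : 0 < β) (hg : ∀ i, ConvexOn ℝ Set.univ (g i))
    (hgd : ∀ i, DifferentiableAt ℝ (g i) x) (hξ : ξ ∈ csubdiff X h x)
    (hw : ‖gradient φ x + ξ + augPenaltyGrad A b g β y z x + (2 * ρ) • (x - xb)‖ ≤ e)
    {u : E} (hu : u ∈ X) :
    φ x + h x + augPenalty A b g β y z x + ρ * ‖x - xb‖ ^ 2 + ρ * ‖u - x‖ ^ 2 - e * ‖u - x‖
      ≤ φ u + h u + augPenalty A b g β y z u + ρ * ‖u - xb‖ ^ 2 := by
  have h1 := hφ.add_inner_gradient_le hφd u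
  have h2 := augPenalty_gradient_ineq (A := A) (b := b) (y := y) (z := z) hβ hg hgd u
  have h3 : ‖u - xb‖ ^ 2 = ‖x - xb‖ ^ 2 + 2 * ⟪x - xb, u - x⟫ + ‖u - x‖ ^ 2 := by
    rw [← norm_add_sq_real]
    congr 2
    abel
  have h4 := hξ u hu
  have h5 := (abs_le.1 (abs_real_inner_le_norm
    (gradient φ x + ξ + augPenaltyGrad A b g β y z x + (2 * ρ) • (x - xb)) (u - x))).1
  have h6 := mul_le_mul_of_nonneg_right hw (norm_nonneg (u - x))
  rw [inner_add_left, inner_add_left, inner_add_left, real_inner_smul_left] at h5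
  rw [h3]
  linarith

theorem inner_augPenaltyGrad_le {X : Set E} {h φ : E → ℝ} {x xb ξ : E} {ρ e C r D : ℝ}
    (hD : ∀ u ∈ X, ∀ u' ∈ X, ‖u - u'‖ ≤ D) (hρ : 0 ≤ ρ) (he : 0 ≤ e) (hr : 0 ≤ r)
    (hC : ‖gradient φ x‖ ≤ C) (hξ : ξ ∈ csubdiff X h x)
    (hh : ∀ u ∈ X, h u - h x ≤ r * ‖u - x‖)
    (hw : ‖gradient φ x + ξ + augPenaltyGrad A b g β y z x + (2 * ρ) • (x - xb)‖ ≤ e)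
    (hx : x ∈ X) (hxb : xb ∈ X) {u : E} (hu : u ∈ X) :
    ⟪augPenaltyGrad A b g β y z x, x - u⟫ ≤ D * (C + 2 * ρ * D + r) + e * D := by
  have hC0 := (norm_nonneg _).trans hC
  have h0 := hD u hu x hx
  have h1 := (abs_le.1 (abs_real_inner_le_norm (gradient φ x) (u - x))).2
  have h2 : ‖gradient φ x‖ * ‖u - x‖ ≤ C * D := mul_le_mul hC h0 (norm_nonneg _) hC0
  have h3 := (hξ u hu)
  have h4 := (hh u hu).trans (mul_le_mul_of_nonneg_left h0 hr)
  have h5 := (abs_le.1 (abs_real_inner_le_norm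
    (gradient φ x + ξ + augPenaltyGrad A b g β y z x + (2 * ρ) • (x - xb)) (u - x))).1
  have h6 : ‖gradient φ x + ξ + augPenaltyGrad A b g β y z x + (2 * ρ) • (x - xb)‖ * ‖u - x‖
    ≤ e * D := mul_le_mul hw h0 (norm_nonneg _) he
  have h7 := real_inner_le_norm (x - xb) (u - x)
  have h8 : ‖x - xb‖ * ‖u - x‖ ≤ D * D :=
    mul_le_mul (hD x hx xb hxb) h0 (norm_nonneg _) ((norm_nonneg _).trans h0)
  have h9 := mul_le_mul_of_nonneg_left (h7.trans h8) (by positivity : 0 ≤ 2 * ρ)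
  rw [inner_add_left, inner_add_left, inner_add_left, real_inner_smul_left] at h5
  rw [← neg_sub u x, inner_neg_right]
  linarith

end

theorem inexact_prox_step_decrease {E : Type*} [NormedAddCommGroup E] {X : Set E} {f h φ : E → ℝ} {x xb : E} {ρ e δ η : ℝ}
    {P : E → ℝ} (hρ : 0 < ρ)
    (hδ : 0 ≤ δ) (he : e ≤ ρ * δ / 2) (hη : η ≤ ρ * δ ^ 2 / 2)
    (hlow : ∀ u, f u - ρ / 2 * ‖u - xb‖ ^ 2 - η ≤ φ u)
    (hup : ∀ u, φ u ≤ f u + ρ / 2 * ‖u - xb‖ ^ 2) (hxb : xb ∈ X)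
    (hS : ∀ u ∈ X, φ x + h x + P x + ρ * ‖x - xb‖ ^ 2 + ρ * ‖u - x‖ ^ 2 - e * ‖u - x‖
      ≤ φ u + h u + P u + ρ * ‖u - xb‖ ^ 2) (hx : 2 * δ < ‖x - xb‖) :
    9 / 2 * ρ * δ ^ 2 ≤ (f xb + h xb + P xb) - (f x + h x + P x) := by
  have h1 := hS xb hxb
  have h2 := hlow x
  have h3 := hup xb
  rw [norm_sub_rev xb x] at h1
  simp only [sub_self, norm_zero] at h1 h3
  set N := ‖x - xb‖
  have h4 := mul_le_mul_of_nonneg_right he (norm_nonneg (x - xb))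
  have h5 : 0 ≤ ρ * ((N - 2 * δ) * (3 / 2 * N + 5 / 2 * δ)) :=
    mul_nonneg hρ.le (mul_nonneg (by linarith) (by linarith))
  linarith

theorem inexact_prox_step_close {E : Type*} [NormedAddCommGroup E] {X : Set E} {f h φ : E → ℝ} {x xb xs : E} {ρ e δ η : ℝ}
    {P : E → ℝ} (hρ : 0 < ρ)
    (hδ : 0 ≤ δ) (he : e ≤ ρ * δ / 2) (hη : η ≤ ρ * δ ^ 2 / 2)
    (hlow : ∀ u, f u - ρ / 2 * ‖u - xb‖ ^ 2 - η ≤ φ u)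
    (hup : ∀ u, φ u ≤ f u + ρ / 2 * ‖u - xb‖ ^ 2) (hxX : x ∈ X)
    (hS : ∀ u ∈ X, φ x + h x + P x + ρ * ‖x - xb‖ ^ 2 + ρ * ‖u - x‖ ^ 2 - e * ‖u - x‖
      ≤ φ u + h u + P u + ρ * ‖u - xb‖ ^ 2) (hxs : xs ∈ X)
    (hmin : ∀ u ∈ X, (f xs + h xs) + P xs + ρ * ‖xs - xb‖ ^ 2 + ρ / 2 * ‖u - xs‖ ^ 2
        ≤ (f u + h u) + P u + ρ * ‖u - xb‖ ^ 2)
    (hx : ‖x - xb‖ ≤ 2 * δ) : ‖xs - xb‖ ≤ 6 * δ := by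
  have h1 := hS xs hxs
  have h2 := hlow x
  have h3 := hup xs
  have h4 := hmin x hxX
  rw [norm_sub_rev x xs] at h4
  have h5 : ‖xs - xb‖ ≤ ‖xs - x‖ + ‖x - xb‖ := norm_sub_le_norm_sub_add_norm_sub _ _ _
  set N := ‖xs - x‖
  set M := ‖x - xb‖
  have hN0 : 0 ≤ N := norm_nonneg _
  have hM0 : 0 ≤ M := norm_nonneg _
  have h6 := mul_le_mul_of_nonneg_right he hN0
  have h7 : ‖xs - xb‖ ^ 2 ≤ (N + M) ^ 2 := by gcongr
  have h8 : ρ * N ^ 2 ≤ ρ * (1 / 2 * δ * N + N * M + M ^ 2 + 1 / 2 * δ ^ 2) := by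
    have := mul_le_mul_of_nonneg_left h7 (by positivity : 0 ≤ ρ / 2)
    linarith
  have h9 := le_of_mul_le_mul_left h8 hρ
  have h10 : N ≤ 4 * δ := by
    by_contra hc
    push Not at hc
    nlinarith
  linarith

theorem exists_summation_weight : ∃ W : ℕ → ℝ, (∀ k, 0 ≤ W k) ∧ (∀ k, W k ≤ 3) ∧
    ∀ k : ℕ, 1 ≤ k → 1 / (((k : ℝ) + 1) * Real.log (k + 1) ^ 2) ≤ W k - W (k + 1) := by
  have hl2 := Real.log_two_gt_d9
  have hlog : ∀ k : ℕ, 2 ≤ k → Real.log 2 ≤ Real.log k := fun k hk =>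
    Real.log_le_log (by norm_num) (by exact_mod_cast hk)
  refine ⟨fun k => if k ≤ 1 then 3 else 1 / Real.log k, fun k => ?_, fun k => ?_, fun k hk => ?_⟩
  · dsimp only
    split_ifs with hk
    · norm_num
    · have := hlog k (by omega)
      have : 0 < Real.log k := by linarith
      positivity
  · dsimp only
    split_ifs with hk
    · exact le_rfl
    · have := hlog k (by omega)
      rw [div_le_iff₀ (by linarith)]
      linarith
  · dsimp only
    rw [if_neg (show ¬ k + 1 ≤ 1 by omega)]
    rcases Nat.lt_or_ge 1 k with h | h
    · rw [if_neg (by omega)]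
      have hk1 := hlog k h
      have hL : 0 < Real.log k := by linarith
      have hk0 : (0 : ℝ) < k := by exact_mod_cast (by omega : 0 < k)
      have h1 : Real.log k + 1 / (k + 1) ≤ Real.log (k + 1) := by
        have h2 := Real.one_sub_inv_le_log_of_pos (show (0 : ℝ) < (k + 1) / k by positivity)
        rw [Real.log_div (by positivity) hk0.ne'] at h2
        have h3 : 1 - (((k : ℝ) + 1) / k)⁻¹ = 1 / (k + 1) := by field_simp; ring
        linarith
      push_cast
      set L := Real.log k
      set L' := Real.log ((k : ℝ) + 1)
      have h0 : 0 < 1 / ((k : ℝ) + 1) := by positivity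
      have hL' : 0 < L' := by linarith
      calc 1 / (((k : ℝ) + 1) * L' ^ 2) = 1 / (k + 1) / (L' * L') := by field_simp
        _ ≤ (L' - L) / (L * L') := by
          gcongr
          · linarith
          · linarith
          · linarith
        _ = _ := by field_simp
    · have hk1 : k = 1 := le_antisymm h hk
      subst hk1
      norm_num
      have h3 : (Real.log 2)⁻¹ ≤ 1.4428 := by
        rw [inv_le_comm₀ (by linarith) (by norm_num)]
        norm_num at hl2 ⊢
        linarith
      have h4 : 0 ≤ (Real.log 2)⁻¹ := by positivity
      have h5 : ((Real.log 2 ^ 2)⁻¹) ≤ 1.4428 ^ 2 := by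
        rw [← inv_pow]
        gcongr
      norm_num at h3 h5
      linarith

theorem norm_le_sqrt_sum_sq_single {d : ℕ} {F : Type*} [NormedAddCommGroup F] [NormedSpace ℝ F]
    (T : EuclideanSpace ℝ (Fin d) →L[ℝ] F) :
    ‖T‖ ≤ √(∑ i, ‖T (EuclideanSpace.single i (1 : ℝ))‖ ^ 2) := by
  refine T.opNorm_le_bound (Real.sqrt_nonneg _) fun u => ?_
  have hu : u = ∑ i, u i • EuclideanSpace.single i (1 : ℝ) := by
    ext j
    simp [Pi.single_apply]
  conv_lhs => rw [hu, map_sum]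
  calc _ ≤ ∑ i, ‖T (u i • EuclideanSpace.single i (1 : ℝ))‖ := norm_sum_le _ _
    _ = ∑ i, ‖T (EuclideanSpace.single i (1 : ℝ))‖ * ‖u i‖ := by
      refine Finset.sum_congr rfl fun i _ => ?_
      rw [map_smul, norm_smul, mul_comm]
    _ ≤ _ := by
      rw [EuclideanSpace.norm_eq]
      exact Real.sum_mul_le_sqrt_mul_sqrt _ _ _

theorem exists_slater_direction {E F ι : Type*} [NormedAddCommGroup E] [InnerProductSpace ℝ E]
    [NormedAddCommGroup F] [InnerProductSpace ℝ F] [FiniteDimensional ℝ E]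
    [FiniteDimensional ℝ F] [CompleteSpace E] [CompleteSpace F]
    {A : E →L[ℝ] F} {b : F} {g : ι → E → ℝ} {X : Set E} {x₀ : E} {τ lam G γ : ℝ}
    (hτ : 0 < τ) (hball : closedBall x₀ τ ⊆ X) (hAx : A x₀ = b) (hG : 0 ≤ G)
    (hGτ : G * τ ≤ γ / 2) (hgx : ∀ i, g i x₀ ≤ -γ)
    (hglip : ∀ i, ∀ u ∈ X, ∀ u' ∈ X, |g i u - g i u'| ≤ G * ‖u - u'‖)
    (hlam : lam = sInf {μ : ℝ | 0 < μ ∧ ∃ w : F, w ≠ 0 ∧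
      A (ContinuousLinearMap.adjoint A w) = μ • w}) (w : E) :
    ∃ u ∈ X, (∀ i, g i u ≤ -(γ / 2)) ∧ τ * √lam * ‖A w‖ ≤ ⟪A w, b - A u⟫ := by
  set a := ContinuousLinearMap.adjoint A (A w) with ha
  have hna : ‖(τ / ‖a‖) • a‖ ≤ τ := by
    rw [norm_smul, Real.norm_of_nonneg (by positivity)]
    calc τ / ‖a‖ * ‖a‖ = τ * (‖a‖ / ‖a‖) := by ring
      _ ≤ τ := mul_le_of_le_one_right hτ.le (div_self_le_one _)
  have hx₀ : x₀ ∈ X := hball (mem_closedBall_self hτ.le)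
  have hu : x₀ - (τ / ‖a‖) • a ∈ X := hball (by
    rw [mem_closedBall, dist_eq_norm, sub_sub_cancel_left, norm_neg]
    exact hna)
  refine ⟨_, hu, fun i => ?_, ?_⟩
  · have h1 := (abs_le.1 (hglip i _ hu _ hx₀)).2
    rw [sub_sub_cancel_left, norm_neg] at h1
    have h2 := mul_le_mul_of_nonneg_left hna hG
    linarith [hgx i]
  · have h1 : ⟪A w, b - A (x₀ - (τ / ‖a‖) • a)⟫ = τ * ‖a‖ := by
      rw [map_sub, hAx, sub_sub_cancel, ← ContinuousLinearMap.adjoint_inner_left, ← ha,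
        real_inner_smul_right, real_inner_self_eq_norm_sq]
      rcases eq_or_ne ‖a‖ 0 with h | h
      · simp [h]
      · field_simp
    have h2 := sq_norm_adjoint_ge_of_mem_range A hlam w
    rw [h1, mul_assoc]
    gcongr
    rw [← Real.sqrt_sq (norm_nonneg (A w)), ← Real.sqrt_sq (norm_nonneg a)]
    rcases le_total 0 lam with h | h
    · rw [← Real.sqrt_mul h]
      exact Real.sqrt_le_sqrt h2
    · rw [Real.sqrt_eq_zero_of_nonpos h, zero_mul]
      positivity

section
variable {V W : Type*} [NormedAddCommGroup V] [NormedAddCommGroup W] [InnerProductSpace ℝ W]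
  [FiniteDimensional ℝ W] {l e : W → ℝ} {M ν : ℝ} {c : V → W}

theorem smoothedModel_convexOn [NormedSpace ℝ V] (hν : 0 < ν)
    (hl : ∀ u w, |l u - l w| ≤ M * ‖u - w‖) (hconv : ConvexOn ℝ Set.univ l)
    (he : ∀ w, e w = sInf {t : ℝ | ∃ q, t = l q + ‖q - w‖ ^ 2 / (2 * ν)}) (xb : V) :
    ConvexOn ℝ Set.univ fun u => e (c xb + fderiv ℝ c xb (u - xb)) := by
  refine ⟨convex_univ, fun u _ u' _ s t hs ht hst => ?_⟩
  have h := (moreau_convexOn hν hl hconv he).2 (Set.mem_univ (c xb + fderiv ℝ c xb (u - xb)))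
    (Set.mem_univ (c xb + fderiv ℝ c xb (u' - xb))) hs ht hst
  refine le_trans (le_of_eq ?_) h
  obtain rfl : t = 1 - s := by linarith
  beta_reduce
  congr 1
  simp only [map_sub, map_add, map_smul]
  module

theorem smoothedModel_differentiable [NormedSpace ℝ V] (hν : 0 < ν)
    (hl : ∀ u w, |l u - l w| ≤ M * ‖u - w‖) (hconv : ConvexOn ℝ Set.univ l)
    (he : ∀ w, e w = sInf {t : ℝ | ∃ q, t = l q + ‖q - w‖ ^ 2 / (2 * ν)}) (xb : V) :
    Differentiable ℝ fun u => e (c xb + fderiv ℝ c xb (u - xb)) :=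
  (moreau_differentiable hν hl hconv he).comp (by fun_prop)

theorem norm_gradient_smoothedModel_le [InnerProductSpace ℝ V] [CompleteSpace V] (hν : 0 < ν)
    (hM : 0 ≤ M) (hl : ∀ u w, |l u - l w| ≤ M * ‖u - w‖)
    (he : ∀ w, e w = sInf {t : ℝ | ∃ q, t = l q + ‖q - w‖ ^ 2 / (2 * ν)}) (xb x : V) :
    ‖gradient (fun u => e (c xb + fderiv ℝ c xb (u - xb))) x‖ ≤ M * ‖fderiv ℝ c xb‖ := by
  refine norm_gradient_le_of_lipschitz (by positivity) (fun u w => ?_) x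
  refine (moreau_lipschitz hν hl he _ _).trans ?_
  rw [mul_assoc]
  gcongr
  rw [add_sub_add_left_eq_sub, ← map_sub, sub_sub_sub_cancel_right]
  exact (fderiv ℝ c xb).le_opNorm _

theorem le_smoothedModel [NormedSpace ℝ V] {L : ℝ} (hν : 0 < ν)
    (hM : 0 ≤ M) (hl : ∀ u w, |l u - l w| ≤ M * ‖u - w‖)
    (he : ∀ w, e w = sInf {t : ℝ | ∃ q, t = l q + ‖q - w‖ ^ 2 / (2 * ν)})
    (hc : Differentiable ℝ c) (hL : ∀ x y, ‖fderiv ℝ c x - fderiv ℝ c y‖ ≤ L * ‖x - y‖)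
    (xb u : V) :
    l (c u) - M * L / 2 * ‖u - xb‖ ^ 2 - ν * M ^ 2 / 2
      ≤ e (c xb + fderiv ℝ c xb (u - xb)) := by
  have h1 := self_sub_le_moreau hν hl he (c xb + fderiv ℝ c xb (u - xb))
  have h2 := (abs_le.1 (hl (c u) (c xb + fderiv ℝ c xb (u - xb)))).2
  have h3 := mul_le_mul_of_nonneg_left (norm_sub_linearization_le hc hL xb u) hM
  linarith

theorem smoothedModel_le [NormedSpace ℝ V] {L : ℝ} (hν : 0 < ν)
    (hM : 0 ≤ M) (hl : ∀ u w, |l u - l w| ≤ M * ‖u - w‖)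
    (he : ∀ w, e w = sInf {t : ℝ | ∃ q, t = l q + ‖q - w‖ ^ 2 / (2 * ν)})
    (hc : Differentiable ℝ c) (hL : ∀ x y, ‖fderiv ℝ c x - fderiv ℝ c y‖ ≤ L * ‖x - y‖)
    (xb u : V) :
    e (c xb + fderiv ℝ c xb (u - xb)) ≤ l (c u) + M * L / 2 * ‖u - xb‖ ^ 2 := by
  have h1 := moreau_le_self hν hl he (c xb + fderiv ℝ c xb (u - xb))
  have h2 := (abs_le.1 (hl (c u) (c xb + fderiv ℝ c xb (u - xb)))).1
  have h3 := mul_le_mul_of_nonneg_left (norm_sub_linearization_le hc hL xb u) hM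
  linarith
end

section
variable {E F ι : Type*} [NormedAddCommGroup E] [InnerProductSpace ℝ E]
  [NormedAddCommGroup F] [InnerProductSpace ℝ F]
  [Fintype ι] {A : E →L[ℝ] F} {b : F} {g : ι → E → ℝ} {β : ℕ → ℝ} {x : ℕ → E} {y : ℕ → F}
  {z : ℕ → ι → ℝ} {α : ℕ → ℝ}

/-- Bound on the number of consecutive steps with a fixed decrease of the augmented
Lagrangian. -/
theorem window_length_le {Φ : E → ℝ} {Fm B c Δ : ℝ} {v pf W : ℕ → ℝ} (hβ0 : ∀ k, 0 < β k)
    (hβmono : Monotone β) (hβ2 : ∀ k, β (k + 1) ≤ 2 * β k) (hB : 0 ≤ B) (hc : 0 ≤ c)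
    (hz : ∀ k, ∀ i, 0 ≤ z k i) (hα : ∀ k, 0 ≤ α k)
    (hpf : ∀ k, pf k = √(‖A (x (k + 1)) - b‖ ^ 2 + ∑ i, max (g i (x (k + 1))) 0 ^ 2))
    (hαv : ∀ k, α k * pf k ≤ v k)
    (hyupd : ∀ k, y (k + 1) = y k + α k • (A (x (k + 1)) - b))
    (hzupd : ∀ k, ∀ i, z (k + 1) i = z k i + α k * max (-(z k i) / β k) (g i (x (k + 1))))
    (hp : ∀ k, ‖y k‖ ^ 2 + ∑ i, z k i ^ 2 ≤ B ^ 2)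
    (hpb : ∀ k, ‖y k + β k • (A (x (k + 1)) - b)‖ ^ 2
        + ∑ i, max (z k i + β k * g i (x (k + 1))) 0 ^ 2 ≤ B ^ 2)
    (hF : ∀ k, |Φ (x (k + 1))| ≤ Fm)
    (hW0 : ∀ k, 0 ≤ W k) (hW3 : ∀ k, W k ≤ 3)
    (hW : ∀ k, 1 ≤ k → v k / β k ≤ c * (W k - W (k + 1))) {s N : ℕ}
    (hdec : ∀ k, s + 1 ≤ k → k < s + 1 + N →
      Δ ≤ (Φ (x k) + augPenalty A b g (β k) (y k) (z k) (x k))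
        - (Φ (x (k + 1)) + augPenalty A b g (β k) (y k) (z k) (x (k + 1)))) :
    N * Δ ≤ 2 * Fm + 14 * B ^ 2 / β 0 + 12 * B * c := by
  set V : ℕ → ℝ := fun k => Φ (x k) + augPenalty A b g (β k) (y k) (z k) (x k)
    + (∑ i, z k i ^ 2) / β k + 4 * B ^ 2 / β k + 4 * B * (c * W k) with hV
  have hzB : ∀ k, ∑ i, z k i ^ 2 ≤ B ^ 2 := fun k => by linarith [hp k, sq_nonneg ‖y k‖]
  have hz2 : ∀ k, 0 ≤ ∑ i, z k i ^ 2 := fun k => by positivity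
  have hβi : ∀ k, β 0 ≤ β k := fun k => hβmono (Nat.zero_le k)
  have hb0 := hβ0 0
  have step : ∀ k, s + 1 ≤ k → k < s + 1 + N → V (k + 1) ≤ V k - Δ := by
    intro k hk1 hk2
    have h1 := augPenalty_update_le (hβ0 k) (hβmono k.le_succ) (hβ2 k) hB (hz k) (hz (k + 1))
      (hα k) (hpf k) (hαv k) (hyupd k) (hzupd k) (hp k) (hp (k + 1)) (hpb k)
    have h2 := hdec k hk1 hk2
    have h3 := mul_le_mul_of_nonneg_left (hW k (by omega)) (by positivity : 0 ≤ 4 * B)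
    have h4 : (∑ i, z (k + 1) i ^ 2) / β (k + 1) ≤ (∑ i, z (k + 1) i ^ 2) / β k :=
      div_le_div_of_nonneg_left (hz2 _) (hβ0 k) (hβmono k.le_succ)
    simp only [hV]
    rw [sub_div] at h1
    have h5 : 4 * B * v k / β k = 4 * B * (v k / β k) := by ring
    have h6 : 4 * B ^ 2 * (1 / β k - 1 / β (k + 1)) = 4 * B ^ 2 / β k - 4 * B ^ 2 / β (k + 1) := by
      ring
    linarith
  have hind : ∀ j ≤ N, V (s + 1 + j) ≤ V (s + 1) - j * Δ := by
    intro j hj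
    induction j with
    | zero => simp
    | succ j ih =>
      have h1 := ih (by omega)
      have h2 := step (s + 1 + j) (by omega) (by omega)
      push_cast
      rw [← add_assoc]
      linarith
  have hend := hind N le_rfl
  have hstart : V (s + 1) ≤ Fm + 13 * B ^ 2 / β 0 + 12 * B * c := by
    have h1 := (abs_le.1 (hF s)).2
    obtain ⟨-, h2, -⟩ := residual_bounds (hβ0 s) (hz s) (hp s) (hpb s)
    have hpf0 : 0 ≤ pf s := hpf s ▸ Real.sqrt_nonneg _
    have hpf2 : pf s ^ 2
        = ‖A (x (s + 1)) - b‖ ^ 2 + ∑ i, max (g i (x (s + 1))) 0 ^ 2 := by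
      rw [hpf, Real.sq_sqrt (by positivity)]
    have h3 : β s * pf s ≤ 2 * B := by
      refine abs_le_of_sq_le_sq' ?_ (by positivity) |>.2
      rw [mul_pow, hpf2]
      linarith
    have h4 := augPenalty_le (hβ0 (s + 1)) hB (hz (s + 1)) (hp (s + 1)) hpf0 hpf2.ge
    have h5 : pf s ≤ 2 * B / β 0 := by
      rw [le_div_iff₀ hb0]
      have := mul_le_mul_of_nonneg_right (hβi s) hpf0
      linarith
    have h6 : 2 * B * pf s ≤ 4 * B ^ 2 / β 0 := by
      calc 2 * B * pf s ≤ 2 * B * (2 * B / β 0) := by gcongr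
        _ = _ := by ring
    have h7 : β (s + 1) / 2 * pf s ^ 2 ≤ 2 * B * pf s := by
      calc β (s + 1) / 2 * pf s ^ 2 ≤ β s * pf s ^ 2 := by
            gcongr
            linarith [hβ2 s]
        _ = β s * pf s * pf s := by ring
        _ ≤ _ := by gcongr
    have h8 : (∑ i, z (s + 1) i ^ 2) / β (s + 1) ≤ B ^ 2 / β 0 :=
      div_le_div₀ (by positivity) (hzB _) hb0 (hβi _)
    have h9 : 4 * B ^ 2 / β (s + 1) ≤ 4 * B ^ 2 / β 0 :=
      div_le_div_of_nonneg_left (by positivity) hb0 (hβi _)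
    have h10 : 4 * B * (c * W (s + 1)) ≤ 4 * B * (c * 3) := by
      gcongr
      exact hW3 _
    simp only [hV]
    have e1 : 13 * B ^ 2 / β 0 = 4 * B ^ 2 / β 0 + 4 * B ^ 2 / β 0 + B ^ 2 / β 0
      + 4 * B ^ 2 / β 0 := by ring
    linarith
  have hlow : -Fm - B ^ 2 / β 0 ≤ V (s + 1 + N) := by
    have h1 : -Fm ≤ Φ (x (s + 1 + N)) := by
      rw [show s + 1 + N = s + N + 1 by ring]
      exact (abs_le.1 (hF _)).1
    have h2 := neg_le_augPenalty (A := A) (b := b) (g := g) (hβ0 (s + 1 + N)) (hp (s + 1 + N))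
      (x (s + 1 + N))
    have h3 : B ^ 2 / (2 * β (s + 1 + N)) ≤ B ^ 2 / β 0 :=
      div_le_div_of_nonneg_left (by positivity) hb0 (by linarith [hβi (s + 1 + N)])
    have h4 : 0 ≤ (∑ i, z (s + 1 + N) i ^ 2) / β (s + 1 + N) := div_nonneg (hz2 _) (hβ0 _).le
    have h5 : 0 ≤ 4 * B ^ 2 / β (s + 1 + N) := div_nonneg (by positivity) (hβ0 _).le
    have h6 : 0 ≤ 4 * B * (c * W (s + 1 + N)) :=
      mul_nonneg (by positivity) (mul_nonneg hc (hW0 _))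
    simp only [hV]
    linarith
  have e2 : 14 * B ^ 2 / β 0 = 13 * B ^ 2 / β 0 + B ^ 2 / β 0 := by ring
  linarith

variable [CompleteSpace E] [CompleteSpace F]

/-- The multipliers of an augmented Lagrangian method stay in a fixed ball under a Slater
condition. -/
theorem multipliers_bounded {X : Set E} {κ R B : ℝ} (hβ : ∀ k, 0 < β k)
    (hα : ∀ k, 0 ≤ α k) (hαβ : ∀ k, α k ≤ β k)
    (hg : ∀ i, ConvexOn ℝ Set.univ (g i)) (hgd : ∀ i, ∀ u ∈ X, DifferentiableAt ℝ (g i) u)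
    (hκ : 0 < κ) (hB : 0 ≤ B) (hRB : R ≤ κ * B)
    (hsl : ∀ w, ∃ u ∈ X, (∀ i, g i u ≤ -κ) ∧ κ * ‖A w‖ ≤ ⟪A w, b - A u⟫)
    (hbA : ∃ w, A w = b) (hxX : ∀ k, x (k + 1) ∈ X)
    (hR : ∀ k, ∀ u ∈ X,
      ⟪augPenaltyGrad A b g (β k) (y k) (z k) (x (k + 1)), x (k + 1) - u⟫ ≤ R)
    (hyupd : ∀ k, y (k + 1) = y k + α k • (A (x (k + 1)) - b))
    (hzupd : ∀ k, ∀ i, z (k + 1) i = z k i + α k * max (-(z k i) / β k) (g i (x (k + 1))))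
    (hy0 : ∃ w, A w = y 0) (hz0 : ∀ i, 0 ≤ z 0 i)
    (hp0 : ‖y 0‖ ^ 2 + ∑ i, z 0 i ^ 2 ≤ B ^ 2) (k : ℕ) :
    ((∃ w, A w = y k) ∧ (∀ i, 0 ≤ z k i) ∧ ‖y k‖ ^ 2 + ∑ i, z k i ^ 2 ≤ B ^ 2) ∧
      ‖y k + β k • (A (x (k + 1)) - b)‖ ^ 2
        + ∑ i, max (z k i + β k * g i (x (k + 1))) 0 ^ 2 ≤ B ^ 2 := by
  obtain ⟨wb, hwb⟩ := hbA
  have step : ∀ k, ((∃ w, A w = y k) ∧ (∀ i, 0 ≤ z k i) ∧ ‖y k‖ ^ 2 + ∑ i, z k i ^ 2 ≤ B ^ 2) →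
      ‖y k + β k • (A (x (k + 1)) - b)‖ ^ 2
        + ∑ i, max (z k i + β k * g i (x (k + 1))) 0 ^ 2 ≤ B ^ 2 := by
    rintro k ⟨⟨w, hw⟩, -, hp⟩
    obtain ⟨u, hu, hgu, hAu⟩ := hsl (w + β k • (x (k + 1) - wb))
    rw [map_add, map_smul, map_sub, hw, hwb] at hAu
    exact multiplier_bound (hβ k) hg (fun i => hgd i _ (hxX k)) hκ hB (hR k u hu) hgu hAu hp hRB
  have main : ∀ k, (∃ w, A w = y k) ∧ (∀ i, 0 ≤ z k i) ∧ ‖y k‖ ^ 2 + ∑ i, z k i ^ 2 ≤ B ^ 2 := by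
    intro k
    induction k with
    | zero => exact ⟨hy0, hz0, hp0⟩
    | succ k ih =>
      obtain ⟨h1, h2⟩ := multiplier_update_bound (hβ k) (hα k) (hαβ k) ih.2.1 (hyupd k) (hzupd k)
        ih.2.2 (step k ih)
      obtain ⟨w, hw⟩ := ih.1
      refine ⟨⟨w + α k • (x (k + 1) - wb), ?_⟩, h2, h1⟩
      rw [map_add, map_smul, map_sub, hw, hwb, hyupd]
  exact ⟨main k, step k (main k)⟩
end

theorem kkt_of_stationary_prox {E F ι : Type*} [NormedAddCommGroup E] [InnerProductSpace ℝ E]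
    [NormedAddCommGroup F] [InnerProductSpace ℝ F] [CompleteSpace E] [CompleteSpace F]
    [Fintype ι] {A : E →L[ℝ] F} {b : F} {g : ι → E → ℝ} {β : ℝ} {y : F} {z : ι → ℝ}
    {X : Set E} {Φ : E → ℝ} {ρ κ R B ε : ℝ} {xs xb : E} (hβ : 0 < β) (hz : ∀ i, 0 ≤ z i)
    (hy : ∃ w, A w = y) (hbA : ∃ w, A w = b) (hg : ∀ i, ConvexOn ℝ Set.univ (g i))
    (hgd : ∀ i, DifferentiableAt ℝ (g i) xs) (hκ : 0 < κ) (hB : 0 ≤ B) (hRB : R ≤ κ * B)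
    (hsl : ∀ w, ∃ u ∈ X, (∀ i, g i u ≤ -κ) ∧ κ * ‖A w‖ ≤ ⟪A w, b - A u⟫)
    (hp : ‖y‖ ^ 2 + ∑ i, z i ^ 2 ≤ B ^ 2)
    (hmem : -(augPenaltyGrad A b g β y z xs + (2 * ρ) • (xs - xb)) ∈ wsubdiff X ρ Φ xs)
    (hR : ∀ u ∈ X, ⟪augPenaltyGrad A b g β y z xs, xs - u⟫ ≤ R) (hρ : 0 ≤ ρ) (hε : 0 ≤ ε)
    (h1 : 2 * ρ * ‖xs - xb‖ ≤ ε) (h2 : 2 * B ≤ ε * β) (h3 : 2 * B ^ 2 ≤ ε * β) :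
    ∃ (yy : F) (zz : ι → ℝ), (∀ i, 0 ≤ zz i) ∧
      infDist (0 : E) {w | ∃ ξ ∈ wsubdiff X ρ Φ xs,
        w = ξ + ContinuousLinearMap.adjoint A yy + ∑ i, zz i • gradient (g i) xs} ≤ ε ∧
      √(‖A xs - b‖ ^ 2 + ∑ i, max (g i xs) 0 ^ 2) ≤ ε ∧ ∑ i, |zz i * g i xs| ≤ ε := by
  obtain ⟨wb, hwb⟩ := hbA
  obtain ⟨wy, hwy⟩ := hy
  obtain ⟨u, hu, hgu, hAu⟩ := hsl (wy + β • (xs - wb))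
  rw [map_add, map_smul, map_sub, hwy, hwb] at hAu
  have hpb := multiplier_bound hβ hg hgd hκ hB (hR u hu) hgu hAu hp hRB
  obtain ⟨-, h4, h5⟩ := residual_bounds hβ hz hp hpb
  refine ⟨y + β • (A xs - b), fun i => max (z i + β * g i xs) 0, fun i => le_max_right _ _,
    ?_, ?_, ?_⟩
  · set G := augPenaltyGrad A b g β y z xs with hG
    refine le_trans (infDist_le_dist_of_mem
      (y := -(G + (2 * ρ) • (xs - xb)) + ContinuousLinearMap.adjoint A (y + β • (A xs - b))
        + ∑ i, max (z i + β * g i xs) 0 • gradient (g i) xs) ?_)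
      (le_trans (le_of_eq ?_) h1)
    · exact ⟨_, hmem, rfl⟩
    rw [dist_zero_left, hG, augPenaltyGrad]
    rw [show ∀ a c e : E, -(a + c + e) + a + c = -e from fun a c e => by abel, norm_neg, norm_smul,
      Real.norm_of_nonneg (by positivity)]
  · rw [Real.sqrt_le_left hε]
    refine le_of_mul_le_mul_left (h4.trans ?_) (by positivity : 0 < β ^ 2)
    calc 4 * B ^ 2 = (2 * B) ^ 2 := by ring
      _ ≤ (ε * β) ^ 2 := by gcongr
      _ = _ := by ring
  · refine le_of_mul_le_mul_left (h5.trans ?_) hβ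
    linarith

theorem exists_slater_constant {E F ι : Type*} [NormedAddCommGroup E] [InnerProductSpace ℝ E]
    [NormedAddCommGroup F] [InnerProductSpace ℝ F] [FiniteDimensional ℝ E]
    [FiniteDimensional ℝ F] [CompleteSpace E] [CompleteSpace F]
    {A : E →L[ℝ] F} {b : F} {g : ι → E → ℝ} {X : Set E} (hX : IsCompact X) {xf : E}
    (hxf : xf ∈ interior X) (hAxf : A xf = b) {G γ M : ℝ} (hG : 0 < G) (hγ : 0 < γ)
    (hM : 1 ≤ M) (hgx : ∀ i, g i xf ≤ -γ)
    (hglip : ∀ i, ∀ u ∈ X, ∀ u' ∈ X, |g i u - g i u'| ≤ G * ‖u - u'‖)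
    {D ρ r C τ Bbar lam θ P Bp Q S Cp : ℝ} (hD : 0 ≤ D) (hρ : 0 < ρ) (hr : 0 ≤ r) (hC : 0 ≤ C)
    (hP : 0 ≤ P) (hS : Q / γ ≤ S)
    (hτ : τ = min (γ / (2 * M * G)) (infDist xf (frontier X)))
    (hBbar : Bbar = D * (r + C) + 2 * ρ * D ^ 2 + D + τ * (1 + r + C + 2 * ρ * D))
    (hlam : lam = sInf {μ : ℝ | 0 < μ ∧ ∃ w : F, w ≠ 0 ∧
        A (ContinuousLinearMap.adjoint A w) = μ • w})
    (hθ : θ = Bbar / min (τ * √lam) (γ / 2)) (hBp : Bp = max P θ)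
    (hQ : Q = D * (C + 2 * ρ * D + r)) (hCp : Cp = 2 * (2 * (Bp + S) + 1)) :
    ∃ κ B : ℝ, 0 < κ ∧ 0 ≤ B ∧ P ≤ B ∧ 3 * B ≤ Cp ∧ Bp ≤ B ∧
      (∀ e, 0 ≤ e → e ≤ 1 → e ≤ ρ * D / 12 → Q + e * D ≤ κ * B) ∧
      ∀ w, ∃ u ∈ X, (∀ i, g i u ≤ -κ) ∧ κ * ‖A w‖ ≤ ⟪A w, b - A u⟫ := by
  have hBp0 : 0 ≤ Bp := hP.trans (hBp ▸ le_max_left _ _)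
  have hQ0 : 0 ≤ Q := hQ ▸ by positivity
  rcases eq_or_ne A 0 with hA | hA
  · refine ⟨γ, max Bp (25 / 24 * (Q / γ)), hγ, le_max_of_le_left hBp0,
      le_max_of_le_left (hBp ▸ le_max_left _ _), ?_, le_max_left _ _, fun e he0 _ he => ?_,
      fun w => ?_⟩
    · have : 0 ≤ Q / γ := by positivity
      rw [mul_max_of_nonneg _ _ (by norm_num)]
      exact max_le (by linarith) (by linarith)
    · have h1 : Q + e * D ≤ 25 / 24 * Q := by
        have h2 := mul_le_mul_of_nonneg_right he hD
        have h3 : 0 ≤ D * (C + r) := by positivity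
        have h4 : 0 ≤ ρ * D * D := by positivity
        rw [hQ]
        linarith
      calc Q + e * D ≤ 25 / 24 * Q := h1
        _ = γ * (25 / 24 * (Q / γ)) := by field_simp
        _ ≤ _ := by
          gcongr
          exact le_max_right _ _
    · exact ⟨xf, interior_subset hxf, hgx, by simp [hA]⟩
  · have hnt : Nontrivial E := by
      by_contra hE
      rw [not_nontrivial_iff_subsingleton] at hE
      exact hA (ContinuousLinearMap.ext fun w => by rw [Subsingleton.elim w 0]; simp)
    have : NoncompactSpace E := NormedSpace.noncompactSpace ℝ E
    have hfr : (frontier X).Nonempty := by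
      rw [nonempty_frontier_iff]
      exact ⟨⟨xf, interior_subset hxf⟩, hX.ne_univ⟩
    have hdist : 0 < infDist xf (frontier X) :=
      (isClosed_frontier.notMem_iff_infDist_pos hfr).1 fun h => h.2 hxf
    have hτ0 : 0 < τ := hτ ▸ lt_min (by positivity) hdist
    have hlam0 : 0 < lam := hlam ▸ sInf_pos_eigenvalues_pos A hA
    set κ := min (τ * √lam) (γ / 2) with hκd
    have hκ : 0 < κ := lt_min (by positivity) (by positivity)
    refine ⟨κ, Bp, hκ, hBp0, hBp ▸ le_max_left _ _, ?_, le_rfl, fun e _ he _ => ?_, fun w => ?_⟩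
    · have : 0 ≤ Q / γ := by positivity
      linarith
    · have h1 : κ * θ ≤ κ * Bp := by
        gcongr
        exact hBp ▸ le_max_right _ _
      have h2 : κ * θ = Bbar := by rw [hθ]; field_simp
      have h3 := mul_le_mul_of_nonneg_right he hD
      have h4 : 0 ≤ τ * (1 + r + C + 2 * ρ * D) := by positivity
      rw [hQ]
      linarith
    · have hball : closedBall xf τ ⊆ X :=
        closedBall_subset_of_le_infDist_frontier hX.isClosed (interior_subset hxf) hτ0
          (hτ ▸ min_le_right _ _)
      have hGτ : G * τ ≤ γ / 2 := by
        calc G * τ ≤ G * (γ / (2 * M * G)) := by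
              gcongr
              exact hτ ▸ min_le_left _ _
          _ = γ / 2 / M := by field_simp
          _ ≤ _ := div_le_self (by positivity) hM
      obtain ⟨u, hu, h1, h2⟩ := exists_slater_direction hτ0 hball hAxf hG.le hGτ hgx hglip hlam w
      refine ⟨u, hu, fun i => (h1 i).trans (neg_le_neg (min_le_right _ _)), le_trans ?_ h2⟩
      gcongr
      exact min_le_left _ _

set_option maxHeartbeats 1000000 in
/-- **Theorem 3, outer iteration complexity for a regularized compositional
objective.** Given `ε > 0`, under Assumptions (A1)–(A4), suppose `f = l ∘ c` with `c`
differentiable with `L_c`-Lipschitz derivative and `l` convex `M_l`-Lipschitz, and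
`ρ := M_l·L_c`. Let `{x^k, y^k, z^k}` be generated by DPALM with the parameter choice
`β_k = β₀√(k+1)`, `v_k = v₀/(√(k+1)(log(k+1))²)`, where each `x^{k+1}` satisfies
`dist(0, ∂_x L̃^ν_{β_k}(x^{k+1}; y^k, z^k)) ≤ ε_k := min{ε/(16C₄), √(ρ/(2β_k)), 1}`, with
`ν := min{1, ε²/(64C₄²ρM_l²)}` and `L̃^ν` the Moreau-envelope smoothed proximal augmented
Lagrangian. Then for some `k ≤ K := ⌈C₅ε⁻²⌉ + ⌈64ρC_xC₄²ε⁻²⌉`, the iterate `x^k` is a near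
`ε`-KKT point of problem (P). -/
theorem dpalm_compositional_near_eps_kkt
    (d n m : ℕ) (hm : 0 < m)
    (A : EuclideanSpace ℝ (Fin d) →L[ℝ] EuclideanSpace ℝ (Fin n))
    (b : EuclideanSpace ℝ (Fin n))
    (f h : EuclideanSpace ℝ (Fin d) → ℝ)
    (g : Fin m → EuclideanSpace ℝ (Fin d) → ℝ)
    (X : Set (EuclideanSpace ℝ (Fin d)))
    -- (A1): X = dom F is compact with diameter D, f is ρ-weakly convex on X, h closed convex
    (hXcomp : IsCompact X) (hXne : X.Nonempty)
    (D : ℝ) (hD : IsGreatest {t | ∃ x₁ ∈ X, ∃ x₂ ∈ X, t = ‖x₁ - x₂‖} D)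
    (ρ : ℝ) (hρ : 0 < ρ)
    (hfwc : ConvexOn ℝ X (fun u => f u + ρ / 2 * ‖u‖ ^ 2))
    (hhconv : ConvexOn ℝ X h) (hhlsc : LowerSemicontinuous h)
    -- (A2): each gᵢ is convex, L_g-smooth on an open set U ⊇ X, with the bounds (B_g)
    (Lg Bg : ℝ) (hBg : 0 < Bg)
    (U : Set (EuclideanSpace ℝ (Fin d))) (hUopen : IsOpen U) (hXU : X ⊆ U)
    (hgconv : ∀ i, ConvexOn ℝ Set.univ (g i))
    (hgdiff : ∀ i, DifferentiableOn ℝ (g i) U)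
    (hgsmooth : ∀ i, ∀ u ∈ U, ∀ u' ∈ U, ‖gradient (g i) u - gradient (g i) u'‖ ≤ Lg * ‖u - u'‖)
    (hgbound : ∀ i, ∀ u ∈ X, |g i u| ≤ Bg ∧ ‖gradient (g i) u‖ ≤ Bg)
    (hglip : ∀ i, ∀ u ∈ X, ∀ u' ∈ X, |g i u - g i u'| ≤ Bg * ‖u - u'‖)
    -- (A3): strictly feasible interior point
    (xfeas : EuclideanSpace ℝ (Fin d)) (hxfeas : xfeas ∈ interior X)
    (hAxfeas : A xfeas = b)
    (gmin : ℝ) (hgminpos : 0 < gmin)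
    (hgmin : IsLeast {t | ∃ i, t = -(g i xfeas)} gmin)
    -- (A4): ∂h(x) ⊆ N_X(x) + B_{r_h} and ∂h(x) ≠ ∅ on X
    (rh : ℝ) (hrh : 0 < rh)
    (hhsubne : ∀ u ∈ X, (csubdiff X h u).Nonempty)
    (hhsub : ∀ u ∈ X, ∀ ξ ∈ csubdiff X h u,
      ∃ w v, ξ = w + v ∧ (∀ u' ∈ X, ⟪w, u' - u⟫ ≤ 0) ∧ ‖v‖ ≤ rh)
    -- DPALM iterates and dual updates
    (β v : ℕ → ℝ) (hβpos : ∀ k, 0 < β k) (hβmono : Monotone β) (hvpos : ∀ k, 0 < v k)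
    (x : ℕ → EuclideanSpace ℝ (Fin d))
    (y : ℕ → EuclideanSpace ℝ (Fin n)) (z : ℕ → Fin m → ℝ)
    (hx0 : x 0 ∈ X) (hy0 : ∃ w, A w = y 0) (hz0 : ∀ i, 0 ≤ z 0 i)
    (α pfeas : ℕ → ℝ)
    (hpfeas : ∀ k, pfeas k =
      Real.sqrt (‖A (x (k + 1)) - b‖ ^ 2 + ∑ i, max (g i (x (k + 1))) 0 ^ 2))
    (hα : ∀ k, α k = if pfeas k = 0 then β k else min (β k) (v k / pfeas k))
    (hyupd : ∀ k, y (k + 1) = y k + α k • (A (x (k + 1)) - b))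
    (hzupd : ∀ k, ∀ i, z (k + 1) i = z k i + α k * max (-(z k i) / β k) (g i (x (k + 1))))
    -- compositional structure: f = l ∘ c, ρ = M_l·L_c
    (p : ℕ)
    (c : EuclideanSpace ℝ (Fin d) → EuclideanSpace ℝ (Fin p))
    (l : EuclideanSpace ℝ (Fin p) → ℝ)
    (Lc Ml : ℝ) (hLc : 0 < Lc) (hMl : 0 < Ml)
    (hcdiff : Differentiable ℝ c)
    (hclip : ∀ x₁ x₂, ‖fderiv ℝ c x₁ - fderiv ℝ c x₂‖ ≤ Lc * ‖x₁ - x₂‖)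
    (hlconv : ConvexOn ℝ Set.univ l)
    (hllip : ∀ u w, |l u - l w| ≤ Ml * ‖u - w‖)
    (hfcomp : ∀ u, f u = l (c u))
    (hρdef : ρ = Ml * Lc)
    -- the Moreau envelope of l
    (lν : ℝ → EuclideanSpace ℝ (Fin p) → ℝ)
    (hlν : ∀ (ν' : ℝ) (w : EuclideanSpace ℝ (Fin p)),
      lν ν' w = sInf {t : ℝ | ∃ q, t = l q + ‖q - w‖ ^ 2 / (2 * ν')})
    -- the parameter choice β_k = β₀√(k+1), v_k = v₀/(√(k+1)(log(k+1))²) (k ≥ 1)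
    (β₀ v₀ : ℝ) (hβ₀ : 0 < β₀) (hv₀ : 0 < v₀)
    (hβch : ∀ k : ℕ, β k = β₀ * Real.sqrt (k + 1))
    (hvch0 : v 0 = v₀)
    (hvch : ∀ k : ℕ, 1 ≤ k → v k = v₀ / (Real.sqrt (k + 1) * Real.log (k + 1) ^ 2))
    -- the constants (with ‖∇c‖ := ‖Dc(x_feas)‖_F + L_c·D and B̄_f := M_l·‖∇c‖)
    (normc Bbarf τ Bbar lamm θ B0 Bp Q C₁ Chp Cp Fmax Cx C₅ C₄ : ℝ)
    (hnormc : normc =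
      Real.sqrt (∑ i, ‖(fderiv ℝ c xfeas) (EuclideanSpace.single i (1 : ℝ))‖ ^ 2) + Lc * D)
    (hBbarf : Bbarf = Ml * normc)
    (hτ : τ = min (gmin / (2 * Real.sqrt m * Bg)) (Metric.infDist xfeas (frontier X)))
    (hBbar : Bbar = D * (rh + Bbarf) + 2 * ρ * D ^ 2 + D + τ * (1 + rh + Bbarf + 2 * ρ * D))
    (hlamm : lamm = sInf {μ : ℝ | 0 < μ ∧ ∃ w : EuclideanSpace ℝ (Fin n), w ≠ 0 ∧
        A (ContinuousLinearMap.adjoint A w) = μ • w})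
    (hθ : θ = Bbar / min (τ * Real.sqrt lamm) (gmin / 2))
    (hB0 : B0 = max (Real.sqrt (‖y 0‖ ^ 2 + ∑ i, z 0 i ^ 2)) θ)
    (hBp : Bp = B0)
    (hQ : Q = D * (Bbarf + 2 * ρ * D + rh))
    (hC₁ : C₁ = 1 / D + 1 / Metric.infDist xfeas (frontier X) + Bg / gmin)
    (hChp : Chp = 2 * (Bp + Real.sqrt (Q ^ 2 / gmin ^ 2
        + Q ^ 2 * ‖(mpPinv (A.comp (ContinuousLinearMap.adjoint A))).comp A‖ ^ 2 * C₁ ^ 2)) + 1)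
    (hCp : Cp = 2 * Chp)
    (hFmax : IsGreatest ((fun u => |f u + h u|) '' X) Fmax)
    (hCx : Cx = 2 * Fmax + 1 / (4 * β₀) * (14 * Cp ^ 2 + 8 * Bp * Cp + 7 * Bp ^ 2)
        + (10 * Cp + 4 * Bp) * (v₀ / β₀)
        + β₀ / 2 * (‖A (x 0) - b‖ ^ 2 + ∑ i, max (g i (x 0) + z 0 i / β₀) 0 ^ 2)
        + |⟪y 0, A (x 0) - b⟫|)
    (hC₅ : C₅ = max (4 * Cp ^ 2 / β₀ ^ 2) (4 * (Bp ^ 2 + 5 / 2 * Cp ^ 2) ^ 2 / β₀ ^ 2))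
    (hC₄ : C₄ = max (3 / 2) (max (3 / (2 * ρ) * Real.sqrt (‖A‖ ^ 2 + m * Bg ^ 2))
        (max (4 * Bg / ρ * Real.sqrt (m * β₀ * Real.sqrt C₅))
          (max (64 / ρ ^ 2 * m * Bg ^ 2 * β₀ * Real.sqrt (ρ * Cx))
            (max (8 * Bg / ρ * Real.sqrt (m * β₀)) (3 / (4 * ρ)))))))
    -- the smoothing parameter, accuracy sequence, and the stationarity requirement
    (ε : ℝ) (hεpos : 0 < ε)
    (ν : ℝ) (hν : ν = min 1 (ε ^ 2 / (64 * C₄ ^ 2 * ρ * Ml ^ 2)))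
    (εseq : ℕ → ℝ)
    (hεseq : ∀ k, εseq k = min (ε / (16 * C₄)) (min (Real.sqrt (ρ / (2 * β k))) 1))
    (happrox : ∀ k, x (k + 1) ∈ X ∧
      Metric.infDist (0 : EuclideanSpace ℝ (Fin d))
        {w | ∃ ξh ∈ csubdiff X h (x (k + 1)),
          w = gradient (fun u => lν ν (c (x k) + (fderiv ℝ c (x k)) (u - x k))) (x (k + 1))
            + ξh
            + ContinuousLinearMap.adjoint A (y k + β k • (A (x (k + 1)) - b))
            + (∑ i, max (z k i + β k * g i (x (k + 1))) 0 • gradient (g i) (x (k + 1)))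
            + (2 * ρ) • (x (k + 1) - x k)} ≤ εseq k)
    (K : ℕ) (hK : K = ⌈C₅ / ε ^ 2⌉₊ + ⌈64 * ρ * Cx * C₄ ^ 2 / ε ^ 2⌉₊)
    :
    ∃ k : ℕ, k ≤ K ∧
      ∃ xs : EuclideanSpace ℝ (Fin d), xs ∈ X ∧ ‖x k - xs‖ ≤ ε ∧
        ∃ (yy : EuclideanSpace ℝ (Fin n)) (zz : Fin m → ℝ),
          (∀ i, 0 ≤ zz i) ∧
          Metric.infDist (0 : EuclideanSpace ℝ (Fin d))
            {w | ∃ ξ ∈ wsubdiff X ρ (fun u => f u + h u) xs,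
              w = ξ + ContinuousLinearMap.adjoint A yy + ∑ i, zz i • gradient (g i) xs} ≤ ε ∧
          Real.sqrt (‖A xs - b‖ ^ 2 + ∑ i, max (g i xs) 0 ^ 2) ≤ ε ∧
          ∑ i, |zz i * g i xs| ≤ ε := by
  have hgd : ∀ i, ∀ u ∈ X, DifferentiableAt ℝ (g i) u := fun i u hu =>
    (hgdiff i).differentiableAt (hUopen.mem_nhds (hXU hu))
  have hg' : ∀ i, ContinuousOn (gradient (g i)) X := fun i =>
    (LipschitzOnWith.of_dist_le_mul (K := Lg.toNNReal) fun u hu w hw => by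
      rw [dist_eq_norm, dist_eq_norm]
      refine (hgsmooth i u hu w hw).trans ?_
      gcongr
      exact Real.le_coe_toNNReal Lg).continuousOn.mono hXU
  have hxfX : xfeas ∈ X := interior_subset hxfeas
  have hDle : ∀ u ∈ X, ∀ u' ∈ X, ‖u - u'‖ ≤ D := fun u hu u' hu' => hD.2 ⟨u, hu, u', hu', rfl⟩
  have hD0 : 0 ≤ D := (norm_nonneg _).trans (hDle _ hxfX _ hxfX)
  have hcn : ∀ u ∈ X, ‖fderiv ℝ c u‖ ≤ normc := fun u hu => by
    have h1 := norm_le_sqrt_sum_sq_single (fderiv ℝ c xfeas)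
    have h2 := (hclip u xfeas).trans (mul_le_mul_of_nonneg_left (hDle u hu _ hxfX) hLc.le)
    have h3 := norm_le_norm_add_norm_sub' (fderiv ℝ c u) (fderiv ℝ c xfeas)
    linarith
  have hBf0 : 0 ≤ Bbarf := by
    rw [hBbarf]
    exact mul_nonneg hMl.le ((norm_nonneg _).trans (hcn _ hxfX))
  have hflip : ∀ u ∈ X, ∀ u' ∈ X, f u - f u' ≤ Bbarf * ‖u - u'‖ := fun u hu u' hu' => by
    have h1 := hfwc.1.norm_image_sub_le_of_norm_fderiv_le (fun w _ => hcdiff w) hcn hu' hu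
    have h2 := (abs_le.1 (hllip (c u) (c u'))).2
    have h3 := mul_le_mul_of_nonneg_left h1 hMl.le
    rw [hfcomp, hfcomp, hBbarf, mul_assoc]
    exact h2.trans h3
  have hhlip : ∀ u ∈ X, ∀ u' ∈ X, h u - h u' ≤ rh * ‖u - u'‖ := fun u hu u' hu' =>
    sub_le_of_csubdiff_subset hhconv.1 hhlsc hhsubne hhsub hxfeas hu hu'
  have hprox : ∀ {β' : ℝ} (y' : EuclideanSpace ℝ (Fin n)) (z' : Fin m → ℝ)
      {xb : EuclideanSpace ℝ (Fin d)}, 0 < β' → xb ∈ X → ∃ xs ∈ X,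
      -(augPenaltyGrad A b g β' y' z' xs + (2 * ρ) • (xs - xb))
        ∈ wsubdiff X ρ (fun u => f u + h u) xs ∧
      (∀ u ∈ X, f xs + h xs + augPenalty A b g β' y' z' xs + ρ * ‖xs - xb‖ ^ 2
        + ρ / 2 * ‖u - xs‖ ^ 2
        ≤ f u + h u + augPenalty A b g β' y' z' u + ρ * ‖u - xb‖ ^ 2) ∧
      ∀ u ∈ X, ⟪augPenaltyGrad A b g β' y' z' xs, xs - u⟫ ≤ Q := by
    intro β' y' z' xb hβ' hxb
    have hΦ : ConvexOn ℝ X fun u => f u + h u + ρ / 2 * ‖u‖ ^ 2 :=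
      (hfwc.add hhconv).congr fun u _ => by simp only [Pi.add_apply]; ring
    obtain ⟨xs, h1, h2, h3, h4⟩ := exists_prox_augLagrangian_minimizer (A := A) (b := b) (y := y')
      (z := z') hXcomp hXne hDle hρ (Φ := fun u => f u + h u) hΦ (C := Bbarf + rh) (by linarith)
      (fun u hu u' hu' => by linarith [hflip u hu u' hu', hhlip u hu u' hu']) hβ' hgconv hgd hg' hxb
    refine ⟨xs, h1, h2, h3, fun u hu => (h4 u hu).trans_eq ?_⟩
    rw [hQ]
    ring
  have hQ0 : 0 ≤ Q := hQ ▸ by positivity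
  have hm1 : 1 ≤ √(m : ℝ) := Real.one_le_sqrt.2 (by exact_mod_cast hm)
  obtain ⟨κ, B, hκ, hB, hPB, hBCp, hBpB, hRB, hsl⟩ := exists_slater_constant (A := A) (b := b)
    (g := g) (M := √m) (γ := gmin) hXcomp hxfeas hAxfeas hBg hgminpos hm1
    (fun i => by linarith [hgmin.2 ⟨i, rfl⟩]) hglip hD0 hρ hrh.le hBf0
    (P := √(‖y 0‖ ^ 2 + ∑ i, z 0 i ^ 2)) (Real.sqrt_nonneg _)
    (S := √(Q ^ 2 / gmin ^ 2
        + Q ^ 2 * ‖(mpPinv (A.comp (ContinuousLinearMap.adjoint A))).comp A‖ ^ 2 * C₁ ^ 2))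
    (Real.le_sqrt_of_sq_le (by
      rw [div_pow]
      have : 0 ≤ Q ^ 2 * ‖(mpPinv (A.comp (ContinuousLinearMap.adjoint A))).comp A‖ ^ 2
        * C₁ ^ 2 := by positivity
      linarith)) hτ hBbar hlamm hθ (hBp.trans hB0) hQ
    (hCp.trans (congrArg (2 * ·) hChp))
  have hQB : Q ≤ κ * B := by simpa using hRB 0 le_rfl zero_le_one (by positivity)
  have hp0 : ‖y 0‖ ^ 2 + ∑ i, z 0 i ^ 2 ≤ B ^ 2 := (Real.sqrt_le_left hB).1 hPB
  by_cases htriv : D ≤ ε ∧ 2 * ρ * D ≤ ε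
  · have hβ' : 0 < (2 * B + 2 * B ^ 2 + 1) / ε := by positivity
    obtain ⟨xs, hxs, h1, -, h2⟩ := hprox (0 : EuclideanSpace ℝ (Fin n)) (0 : Fin m → ℝ) hβ' hx0
    have h3 : ε * ((2 * B + 2 * B ^ 2 + 1) / ε) = 2 * B + 2 * B ^ 2 + 1 := by field_simp
    refine ⟨0, Nat.zero_le _, xs, hxs, (hDle _ hx0 _ hxs).trans htriv.1, ?_⟩
    have h4 := hDle _ hxs _ hx0
    refine kkt_of_stationary_prox (z := (0 : Fin m → ℝ)) hβ' (fun i => le_rfl) ⟨0, map_zero A⟩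
      ⟨xfeas, hAxfeas⟩ hgconv (fun i => hgd i _ hxs) hκ hB hQB hsl (by simp; positivity) h1 h2
      hρ.le hεpos.le ?_ ?_ ?_
    · exact (mul_le_mul_of_nonneg_left h4 (by positivity)).trans htriv.2
    · rw [h3]
      linarith [sq_nonneg B]
    · rw [h3]
      linarith
  have hC4a : 3 / 2 ≤ C₄ := hC₄ ▸ le_max_left _ _
  have hC4b : 3 / (4 * ρ) ≤ C₄ := by
    rw [hC₄]
    exact (((((le_max_right _ _).trans (le_max_right _ _)).trans (le_max_right _ _)).trans
      (le_max_right _ _)).trans (le_max_right _ _))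
  have hC40 : 0 < C₄ := by linarith
  have hC4b' : 3 ≤ 4 * ρ * C₄ := by
    rw [div_le_iff₀ (by positivity)] at hC4b
    linarith
  have hε16 : ε / (16 * C₄) ≤ ρ * D / 12 := by
    rw [div_le_iff₀ (by positivity)]
    rcases not_and_or.1 htriv with hlt | hlt
    · linarith [mul_le_mul_of_nonneg_left hC4b' hD0]
    · linarith [mul_le_mul_of_nonneg_left hC4a (mul_nonneg hρ.le hD0)]
  have hε0 : ∀ k, 0 ≤ εseq k := fun k => by
    rw [hεseq]
    positivity
  have hε1 : ∀ k, εseq k ≤ ε / (16 * C₄) := fun k => hεseq k ▸ min_le_left _ _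
  have hε2 : ∀ k, εseq k ≤ 1 := fun k =>
    hεseq k ▸ (min_le_right _ _).trans (min_le_right _ _)
  have hν0 : 0 < ν := hν ▸ by positivity
  set δ := ε / (8 * ρ * C₄) with hδ
  have hδ0 : 0 < δ := by positivity
  have hεδ : ∀ k, εseq k ≤ ρ * δ / 2 := fun k => (hε1 k).trans_eq (by rw [hδ]; field_simp; norm_num)
  have hνδ : ν * Ml ^ 2 / 2 ≤ ρ * δ ^ 2 / 2 := by
    have h1 : ν * Ml ^ 2 ≤ ε ^ 2 / (64 * C₄ ^ 2 * ρ * Ml ^ 2) * Ml ^ 2 := by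
      gcongr
      exact hν ▸ min_le_right _ _
    have h2 : ε ^ 2 / (64 * C₄ ^ 2 * ρ * Ml ^ 2) * Ml ^ 2 = ρ * δ ^ 2 := by
      rw [hδ]
      field_simp
      norm_num
    linarith
  have hxX : ∀ k, x k ∈ X := fun k => by
    cases k with
    | zero => exact hx0
    | succ k => exact (happrox k).1
  set φ : ℕ → EuclideanSpace ℝ (Fin d) → ℝ := fun k u =>
    lν ν (c (x k) + (fderiv ℝ c (x k)) (u - x k)) with hφ
  have hstat : ∀ k, ∃ ξ ∈ csubdiff X h (x (k + 1)),
      ‖gradient (φ k) (x (k + 1)) + ξ + augPenaltyGrad A b g (β k) (y k) (z k) (x (k + 1))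
        + (2 * ρ) • (x (k + 1) - x k)‖ ≤ εseq k := fun k => by
    obtain ⟨ξ, hξ, hle⟩ := exists_norm_le_of_infDist_le (isClosed_csubdiff X h _)
      (hhsubne _ (happrox k).1) (happrox k).2
    refine ⟨ξ, hξ, ?_⟩
    rwa [augPenaltyGrad, ← add_assoc (gradient (φ k) (x (k + 1)) + ξ)]
  have hφconv : ∀ k, ConvexOn ℝ Set.univ (φ k) := fun k =>
    smoothedModel_convexOn hν0 hllip hlconv (hlν ν) (x k)
  have hφd : ∀ k, Differentiable ℝ (φ k) := fun k =>
    smoothedModel_differentiable hν0 hllip hlconv (hlν ν) (x k)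
  have hφg : ∀ k u, ‖gradient (φ k) u‖ ≤ Bbarf := fun k u =>
    (norm_gradient_smoothedModel_le hν0 hMl.le hllip (hlν ν) (x k) u).trans (by
      rw [hBbarf]
      exact mul_le_mul_of_nonneg_left (hcn _ (hxX k)) hMl.le)
  have hφlow : ∀ k u, f u - ρ / 2 * ‖u - x k‖ ^ 2 - ν * Ml ^ 2 / 2 ≤ φ k u := fun k u => by
    rw [hfcomp, hρdef]
    exact le_smoothedModel hν0 hMl.le hllip (hlν ν) hcdiff hclip (x k) u
  have hφup : ∀ k u, φ k u ≤ f u + ρ / 2 * ‖u - x k‖ ^ 2 := fun k u => by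
    rw [hfcomp, hρdef]
    exact smoothedModel_le hν0 hMl.le hllip (hlν ν) hcdiff hclip (x k) u
  have hgrowth : ∀ k, ∀ u ∈ X, φ k (x (k + 1)) + h (x (k + 1))
      + augPenalty A b g (β k) (y k) (z k) (x (k + 1)) + ρ * ‖x (k + 1) - x k‖ ^ 2
      + ρ * ‖u - x (k + 1)‖ ^ 2 - εseq k * ‖u - x (k + 1)‖
      ≤ φ k u + h u + augPenalty A b g (β k) (y k) (z k) u + ρ * ‖u - x k‖ ^ 2 := by
    intro k u hu
    obtain ⟨ξ, hξ, hle⟩ := hstat k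
    exact inexact_stationary_growth (hφconv k) (hφd k _) (hβpos k) hgconv
      (fun i => hgd i _ (hxX _)) hξ hle hu
  set e₀ := min 1 (ρ * D / 12) with he₀
  have he₀0 : 0 ≤ e₀ := by positivity
  have hεe₀ : ∀ k, εseq k ≤ e₀ := fun k => le_min (hε2 k) ((hε1 k).trans hε16)
  have hR : ∀ k, ∀ u ∈ X,
      ⟪augPenaltyGrad A b g (β k) (y k) (z k) (x (k + 1)), x (k + 1) - u⟫ ≤ Q + e₀ * D := by
    intro k u hu
    obtain ⟨ξ, hξ, hle⟩ := hstat k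
    rw [hQ]
    exact inner_augPenaltyGrad_le hDle hρ.le he₀0 hrh.le (hφg k _) hξ
      (fun u hu => hhlip u hu _ (hxX _)) (hle.trans (hεe₀ k)) (hxX _) (hxX k) hu
  have hpf0 : ∀ k, 0 ≤ pfeas k := fun k => hpfeas k ▸ Real.sqrt_nonneg _
  have hα0 : ∀ k, 0 ≤ α k := fun k => by
    rw [hα]
    split_ifs
    · exact (hβpos k).le
    · exact le_min (hβpos k).le (div_nonneg (hvpos k).le (hpf0 k))
  have hαβ : ∀ k, α k ≤ β k := fun k => by
    rw [hα]
    split_ifs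
    · exact le_rfl
    · exact min_le_left _ _
  have hαv : ∀ k, α k * pfeas k ≤ v k := fun k => by
    by_cases h0 : pfeas k = 0
    · rw [h0, mul_zero]
      exact (hvpos k).le
    · have h1 : 0 < pfeas k := lt_of_le_of_ne (hpf0 k) (Ne.symm h0)
      rw [← le_div_iff₀ h1, hα, if_neg h0]
      exact min_le_right _ _
  have hmult := multipliers_bounded hβpos hα0 hαβ hgconv hgd hκ hB
    (hRB e₀ he₀0 (min_le_left _ _) (min_le_right _ _)) hsl ⟨xfeas, hAxfeas⟩
    (fun k => (happrox k).1) hR hyupd hzupd hy0 hz0 hp0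
  have hβ00 : β 0 = β₀ := by simp [hβch]
  have hβ2 : ∀ k, β (k + 1) ≤ 2 * β k := fun k => by
    rw [hβch, hβch, mul_left_comm]
    gcongr
    rw [Real.sqrt_le_left (by positivity), mul_pow, Real.sq_sqrt (by positivity)]
    push_cast
    have : (0 : ℝ) ≤ k := Nat.cast_nonneg k
    linarith
  have hCp2 : 2 ≤ Cp := by
    have h1 : 0 ≤ Bp := hBp ▸ hB0 ▸ le_max_of_le_left (Real.sqrt_nonneg _)
    have h2 := Real.sqrt_nonneg (Q ^ 2 / gmin ^ 2
        + Q ^ 2 * ‖(mpPinv (A.comp (ContinuousLinearMap.adjoint A))).comp A‖ ^ 2 * C₁ ^ 2)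
    rw [hCp, hChp]
    linarith
  have hBp0 : 0 ≤ Bp := hBp ▸ hB0 ▸ le_max_of_le_left (Real.sqrt_nonneg _)
  have hC5a : 4 * Cp ^ 2 ≤ C₅ * β₀ ^ 2 := by
    rw [← div_le_iff₀ (by positivity), hC₅]
    exact le_max_left _ _
  have hC5b : 4 * (Bp ^ 2 + 5 / 2 * Cp ^ 2) ^ 2 ≤ C₅ * β₀ ^ 2 := by
    rw [← div_le_iff₀ (by positivity), hC₅]
    exact le_max_right _ _
  have hC50 : 0 < C₅ := by
    rw [hC₅]
    exact lt_max_of_lt_left (by positivity)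
  obtain ⟨s, hs⟩ : ∃ s, ⌈C₅ / ε ^ 2⌉₊ = s + 1 :=
    Nat.exists_eq_succ_of_ne_zero (Nat.ceil_pos.2 (by positivity)).ne'
  set N := ⌈64 * ρ * Cx * C₄ ^ 2 / ε ^ 2⌉₊ with hN
  obtain ⟨k, hk1, hk2, hk⟩ : ∃ k, s + 1 ≤ k ∧ k < s + 1 + N ∧ ‖x (k + 1) - x k‖ ≤ 2 * δ := by
    by_contra! hcon
    obtain ⟨W, hW0, hW3, hW⟩ := exists_summation_weight
    have hlen := window_length_le (A := A) (b := b) (g := g) (Φ := fun u => f u + h u)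
      (Fm := Fmax) (B := B) (c := v₀ / β₀) (Δ := 9 / 2 * ρ * δ ^ 2) (v := v) (pf := pfeas)
      hβpos hβmono hβ2 hB (by positivity) (fun k => (hmult k).1.2.1) hα0 hpfeas hαv hyupd hzupd
      (fun k => (hmult k).1.2.2) (fun k => (hmult k).2)
      (fun k => hFmax.2 ⟨_, hxX (k + 1), rfl⟩) hW0 hW3 (fun k hk => by
        refine le_trans (le_of_eq ?_) (mul_le_mul_of_nonneg_left (hW k hk) (by positivity))
        have h1 : √((k : ℝ) + 1) * √((k : ℝ) + 1) = k + 1 := Real.mul_self_sqrt (by positivity)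
        rw [hvch k hk, hβch]
        generalize Real.log ((k : ℝ) + 1) = t
        rw [← h1]
        simp only [div_eq_mul_inv, mul_inv, Real.sqrt_mul_self (Real.sqrt_nonneg _)]
        ring) (s := s) (N := N) (fun k hk1 hk2 =>
        inexact_prox_step_decrease (P := augPenalty A b g (β k) (y k) (z k)) hρ hδ0.le (hεδ k)
          hνδ (hφlow k) (hφup k) (hxX k) (hgrowth k) (hcon k hk1 hk2))
    have h1 : Cx ≤ N * (ρ * δ ^ 2) := by
      calc Cx = 64 * ρ * Cx * C₄ ^ 2 / ε ^ 2 * (ρ * δ ^ 2) := by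
            rw [hδ]
            field_simp
            norm_num
        _ ≤ _ := by
            gcongr
            exact Nat.le_ceil _
    have hF0 : 0 ≤ Fmax := (abs_nonneg _).trans (hFmax.2 ⟨_, hx0, rfl⟩)
    have h2 : 2 * Fmax + 14 * Cp ^ 2 / (4 * β₀) + 10 * Cp * (v₀ / β₀) ≤ Cx := by
      have h3 : 0 ≤ β₀ / 2 * (‖A (x 0) - b‖ ^ 2 + ∑ i, max (g i (x 0) + z 0 i / β₀) 0 ^ 2) := by
        positivity
      have h4 := abs_nonneg ⟪y 0, A (x 0) - b⟫
      have h5 : 0 ≤ 1 / (4 * β₀) * (8 * Bp * Cp + 7 * Bp ^ 2) := by positivity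
      have h6 : 0 ≤ 4 * Bp * (v₀ / β₀) := by positivity
      have h7 : 1 / (4 * β₀) * (14 * Cp ^ 2 + 8 * Bp * Cp + 7 * Bp ^ 2)
        = 14 * Cp ^ 2 / (4 * β₀) + 1 / (4 * β₀) * (8 * Bp * Cp + 7 * Bp ^ 2) := by ring
      rw [hCx, h7]
      linarith
    have h3 : 9 * (B ^ 2 / β₀) ≤ Cp ^ 2 / β₀ := by
      rw [← mul_div_assoc]
      gcongr
      calc 9 * B ^ 2 = (3 * B) ^ 2 := by ring
        _ ≤ _ := by gcongr
    have h4 : 3 * B * (v₀ / β₀) ≤ Cp * (v₀ / β₀) := by gcongr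
    have h5 : 0 < Cp ^ 2 / β₀ := by positivity
    have h6 : 0 ≤ B * (v₀ / β₀) := by positivity
    rw [hβ00] at hlen
    have e1 : 14 * B ^ 2 / β₀ = 14 * (B ^ 2 / β₀) := by ring
    have e2 : 14 * Cp ^ 2 / (4 * β₀) = 7 / 2 * (Cp ^ 2 / β₀) := by
      field_simp
      norm_num
    rw [e2] at h2
    rw [e1] at hlen
    linarith
  obtain ⟨xs, hxs, hmem, hmin, hRs⟩ := hprox (y k) (z k) (hβpos k) (hxX k)
  have hclose : ‖xs - x k‖ ≤ 6 * δ := inexact_prox_step_close (x := x (k + 1))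
    (P := augPenalty A b g (β k) (y k) (z k)) hρ hδ0.le (hεδ k) hνδ (hφlow k) (hφup k)
    (hxX (k + 1)) (hgrowth k) hxs hmin hk
  have h6a : 6 * δ ≤ ε := by
    rw [hδ, ← mul_div_assoc, div_le_iff₀ (by positivity)]
    linarith [mul_le_mul_of_nonneg_left hC4b' hεpos.le]
  have h6b : 2 * ρ * (6 * δ) ≤ ε := by
    have : 2 * ρ * (6 * δ) = 3 / 2 * ε / C₄ := by
      rw [hδ]
      field_simp
      norm_num
    rw [this, div_le_iff₀ hC40]
    linarith [mul_le_mul_of_nonneg_left hC4a hεpos.le]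
  have hbig : C₅ * β₀ ^ 2 ≤ (ε * β k) ^ 2 := by
    have h1 : C₅ / ε ^ 2 ≤ k + 1 := by
      have h2 : ((s + 1 : ℕ) : ℝ) ≤ k := by exact_mod_cast hk1
      have h3 := Nat.le_ceil (C₅ / ε ^ 2)
      rw [hs] at h3
      linarith
    rw [div_le_iff₀ (by positivity)] at h1
    rw [hβch, mul_pow, mul_pow, Real.sq_sqrt (by positivity)]
    calc C₅ * β₀ ^ 2 ≤ (k + 1) * ε ^ 2 * β₀ ^ 2 := by gcongr
      _ = _ := by ring
  have hBCp' : B ≤ Cp := by linarith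
  refine ⟨k, by rw [hK, hs]; exact hk2.le, xs, hxs, ?_, ?_⟩
  · rw [norm_sub_rev]
    exact hclose.trans h6a
  · refine kkt_of_stationary_prox (hβpos k) (hmult k).1.2.1 (hmult k).1.1 ⟨xfeas, hAxfeas⟩ hgconv
      (fun i => hgd i _ hxs) hκ hB hQB hsl (hmult k).1.2.2 hmem hRs hρ.le hεpos.le ?_ ?_ ?_
    · exact (mul_le_mul_of_nonneg_left hclose (by positivity)).trans h6b
    · refine abs_le_of_sq_le_sq' (le_trans ?_ (hC5a.trans hbig))
        (mul_nonneg hεpos.le (hβpos k).le) |>.2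
      calc (2 * B) ^ 2 = 4 * B ^ 2 := by ring
        _ ≤ _ := by gcongr
    · refine abs_le_of_sq_le_sq' (le_trans ?_ (hC5b.trans hbig))
        (mul_nonneg hεpos.le (hβpos k).le) |>.2
      calc (2 * B ^ 2) ^ 2 = 4 * (B ^ 2) ^ 2 := by ring
        _ ≤ _ := by
          gcongr
          have : B ^ 2 ≤ Cp ^ 2 := by gcongr
          linarith [sq_nonneg Bp, sq_nonneg Cp]
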